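/- arXiv:1504.04470 — 3 statements merged into one kernel-verified Lean document; each statement's English description precedes it below -/
import Mathlib

section
/- Let G be a non-chordal proper Helly circular-arc graph with a proper and Helly arc model A. For every editing set (V*, E*, ∅) of G, there exist a point α of the circle and a set V_- of vertices with |V_-| ≤ |V*| such that (V_-, E→_{A−V_-}(α), ∅) is an editing set of G and |E→_{A−V_-}(α)| ≤ |E*|, where A − V_- denotes the arc model for G − V_- obtained from A by removing the arcs of the vertices in V_-. -/
/-- A unit interval graph: vertices can be mapped to reals so that two distinct
vertices are adjacent iff their images are within distance 1. -/
def SimpleGraph.IsUnitIntervalGraph {V : Type*} (G : SimpleGraph V) : Prop :=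
  ∃ f : V → ℝ, ∀ u v : V, u ≠ v → (G.Adj u v ↔ |f u - f v| ≤ 1)

/-- `f : ZMod n → V` describes a hole (induced cycle of length `n ≥ 4`) of `G`. -/
def SimpleGraph.IsHoleOn {V : Type*} (G : SimpleGraph V) (n : ℕ) (f : ZMod n → V) : Prop :=
  4 ≤ n ∧ Function.Injective f ∧
    ∀ i j : ZMod n, (G.Adj (f i) (f j) ↔ (i = j + 1 ∨ j = i + 1))

def SimpleGraph.HasHole {V : Type*} (G : SimpleGraph V) : Prop :=
  ∃ (n : ℕ) (f : ZMod n → V), G.IsHoleOn n f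

/-- A graph is chordal if it has no hole. -/
def SimpleGraph.Chordal {V : Type*} (G : SimpleGraph V) : Prop := ¬ G.HasHole

/-- `G` contains an induced copy of `H`. -/
def SimpleGraph.HasInducedCopy {V W : Type*} (G : SimpleGraph V) (H : SimpleGraph W) : Prop :=
  ∃ f : W → V, Function.Injective f ∧ ∀ a b : W, G.Adj (f a) (f b) ↔ H.Adj a b

/-- The claw `K_{1,3}`, centered at vertex `0`. -/
def clawGraph : SimpleGraph (Fin 4) := SimpleGraph.fromRel (fun a _ => a = 0)

/-- The tent `S_3`: triangle on `0,1,2`; vertex `i+3` adjacent to `{0,1,2} \ {i}`. -/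
def tentGraph : SimpleGraph (Fin 6) := SimpleGraph.fromRel (fun a b =>
  (a.val < 3 ∧ b.val < 3) ∨ (a.val < 3 ∧ 3 ≤ b.val ∧ b.val ≠ a.val + 3))

/-- The net: triangle on `0,1,2`; pendant vertex `i+3` adjacent exactly to `i`. -/
def netGraph : SimpleGraph (Fin 6) := SimpleGraph.fromRel (fun a b =>
  (a.val < 3 ∧ b.val < 3) ∨ (a.val < 3 ∧ b.val = a.val + 3))

/-- The cycle `C_n` on `ZMod n`. -/
def cycleG (n : ℕ) : SimpleGraph (ZMod n) := SimpleGraph.fromRel (fun a b => a = b + 1)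

/-- The wheel `W_n`: a cycle `C_n` plus a hub (`none`) adjacent to all cycle vertices. -/
def wheelG (n : ℕ) : SimpleGraph (Option (ZMod n)) := SimpleGraph.fromRel (fun a b =>
  a = none ∨ ∃ i j : ZMod n, a = some i ∧ b = some j ∧ i = j + 1)

/-- `C*_n`: a cycle `C_n` plus an isolated vertex (`none`). -/
def cycleStarG (n : ℕ) : SimpleGraph (Option (ZMod n)) := SimpleGraph.fromRel (fun a b =>
  ∃ i j : ZMod n, a = some i ∧ b = some j ∧ i = j + 1)

/-- Raw data of a family of closed arcs on the circle `ℝ/Lℤ`: each vertex `v` gets the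
arc traversed clockwise from (the image of) `src v` to `src v + len v`. -/
structure PreArcModel (V : Type*) where
  L : ℝ
  L_pos : 0 < L
  src : V → ℝ
  len : V → ℝ
  len_pos : ∀ v, 0 < len v
  len_lt : ∀ v, len v < L

namespace PreArcModel

variable {V : Type*}

/-- The counterclockwise endpoint of the arc of `v`. -/
noncomputable def ccp (A : PreArcModel V) (v : V) : AddCircle A.L := (A.src v : ℝ)

/-- The clockwise endpoint of the arc of `v`. -/
noncomputable def cp (A : PreArcModel V) (v : V) : AddCircle A.L :=
  ((A.src v + A.len v : ℝ) : AddCircle A.L)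

/-- The closed arc assigned to `v`, as a subset of the circle. -/
noncomputable def arc (A : PreArcModel V) (v : V) : Set (AddCircle A.L) :=
  (fun x : ℝ => (x : AddCircle A.L)) '' Set.Icc (A.src v) (A.src v + A.len v)

/-- All endpoints of all arcs are pairwise distinct. -/
def EndpointsDistinct (A : PreArcModel V) : Prop :=
  Function.Injective (fun p : V × Bool => if p.2 then A.cp p.1 else A.ccp p.1)

/-- `A` is an arc model of the graph `G`: endpoints are pairwise distinct and two
distinct vertices are adjacent iff their arcs intersect. -/
def IsModelOf (A : PreArcModel V) (G : SimpleGraph V) : Prop :=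
  A.EndpointsDistinct ∧ ∀ u v : V, u ≠ v → (G.Adj u v ↔ (A.arc u ∩ A.arc v).Nonempty)

/-- No arc is properly contained in another arc. -/
def Proper (A : PreArcModel V) : Prop := ∀ u v : V, ¬ A.arc u ⊂ A.arc v

/-- Every set of pairwise intersecting arcs has a common point. -/
def Helly (A : PreArcModel V) : Prop :=
  ∀ S : Set V, (∀ u ∈ S, ∀ v ∈ S, (A.arc u ∩ A.arc v).Nonempty) →
    (⋂ v ∈ S, A.arc v).Nonempty

/-- The set `K_A(α)` of vertices whose arc contains the point `α`. -/
noncomputable def K (A : PreArcModel V) (α : AddCircle A.L) : Set V := {v | α ∈ A.arc v}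

/-- The edge set `E→_A(α)`: edges `vu` of `G` with `v ∈ K_A(α)`, `u ∉ K_A(α)`,
and `A(v)` intersecting `A(u)` from the left (`cp v ∈ A(u)`). -/
noncomputable def Eout (A : PreArcModel V) (G : SimpleGraph V) (α : AddCircle A.L) :
    Set (Sym2 V) :=
  {e | ∃ v u : V, e = s(v, u) ∧ G.Adj v u ∧ α ∈ A.arc v ∧ α ∉ A.arc u ∧ A.cp v ∈ A.arc u}

/-- The edge set `E→_{A - Vm}(α)` of the model obtained by removing the arcs of `Vm`. -/
noncomputable def EoutAvoid (A : PreArcModel V) (G : SimpleGraph V) (Vm : Set V)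
    (α : AddCircle A.L) : Set (Sym2 V) :=
  {e | ∃ v u : V, e = s(v, u) ∧ G.Adj v u ∧ v ∉ Vm ∧ u ∉ Vm ∧
    α ∈ A.arc v ∧ α ∉ A.arc u ∧ A.cp v ∈ A.arc u}

end PreArcModel

/-- A proper Helly circular-arc graph: a graph admitting an arc model that is both
proper and Helly. -/
def SimpleGraph.IsPHCA {V : Type*} (G : SimpleGraph V) : Prop :=
  ∃ A : PreArcModel V, A.IsModelOf G ∧ A.Proper ∧ A.Helly

/-- Adjacency pattern of a fat `W_5` among the six clique-classes: classes `0..4`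
form the fat hole (consecutive classes modulo 5 are completely adjacent), class `5`
is the hub (completely adjacent to everything), and each class is a clique. -/
def fatW5Rel (p q : Fin 6) : Prop :=
  p = q ∨ p = 5 ∨ q = 5 ∨ (p.val + 1) % 5 = q.val ∨ (q.val + 1) % 5 = p.val

/-- A fat `W_5`: vertex set partitioned into six nonempty cliques with the `W_5`
adjacency pattern between the classes. -/
def SimpleGraph.IsFatW5 {V : Type*} (G : SimpleGraph V) : Prop :=
  ∃ part : V → Fin 6, Function.Surjective part ∧
    ∀ u v : V, u ≠ v → (G.Adj u v ↔ fatW5Rel (part u) (part v))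

/-- `Gb` is a maximum spanning unit interval subgraph of `G`. -/
def IsMaxSpanningUIG {V : Type*} (G Gb : SimpleGraph V) : Prop :=
  Gb ≤ G ∧ Gb.IsUnitIntervalGraph ∧
    ∀ H : SimpleGraph V, H ≤ G → H.IsUnitIntervalGraph →
      H.edgeSet.ncard ≤ Gb.edgeSet.ncard

/-- `(Vm, Em, Ep)` is an editing set of `G`: `Em` is a set of edges of `G - Vm`,
`Ep` a set of non-edges of `G - Vm`, and deleting `Em` and adding `Ep` makes
`G - Vm` a unit interval graph. -/
def IsEditingSet {V : Type*} (G : SimpleGraph V) (Vm : Set V) (Em Ep : Set (Sym2 V)) : Prop :=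
  Em ⊆ G.edgeSet ∧ (∀ e ∈ Em, ∀ x ∈ e, x ∉ Vm) ∧
  (∀ e ∈ Ep, ¬ e.IsDiag ∧ e ∉ G.edgeSet ∧ ∀ x ∈ e, x ∉ Vm) ∧
  ((SimpleGraph.fromEdgeSet ((G.edgeSet \ Em) ∪ Ep)).induce {v | v ∉ Vm}).IsUnitIntervalGraph

/-- A choice of real lifts `[x v, x v + ℓ v]` of the arcs of a proper arc model on the circle
of length `L`: the order of left endpoints and right endpoints agree among all translates. -/
structure ProperLift {W : Type*} (L : ℝ) (x ℓ : W → ℝ) : Prop where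
  L_pos : 0 < L
  len_pos : ∀ v, 0 < ℓ v
  len_lt : ∀ v, ℓ v < L
  mono : ∀ u v (k : ℤ), x u < x v + k * L → x u + ℓ u < x v + k * L + ℓ v
  inj : ∀ u v (k : ℤ), x u = x v + k * L → u = v

/-- The lift of `u` meets the lift of `v` translated by `k` turns. -/
def LiftsMeet {W : Type*} (L : ℝ) (x ℓ : W → ℝ) (u v : W) (k : ℤ) : Prop :=
  x u ≤ x v + k * L + ℓ v ∧ x v + k * L ≤ x u + ℓ u

section Exchange

variable {W : Type*} {L : ℝ} {x ℓ : W → ℝ}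

lemma ProperLift.shift (h : ProperLift L x ℓ) (φ : W → ℤ) :
    ProperLift L (fun v => x v + φ v * L) ℓ where
  L_pos := h.L_pos
  len_pos := h.len_pos
  len_lt := h.len_lt
  mono u v k hk := by
    have := h.mono u v (k + φ v - φ u) (by push_cast; linarith)
    push_cast at this
    linarith
  inj u v k hk := h.inj u v (k + φ v - φ u) (by push_cast; linarith)

lemma liftsMeet_shift (φ : W → ℤ) (u v : W) (k : ℤ) :
    LiftsMeet L (fun v => x v + φ v * L) ℓ u v k ↔ LiftsMeet L x ℓ u v (k + φ v - φ u) := by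
  unfold LiftsMeet
  push_cast
  constructor <;> rintro ⟨h₁, h₂⟩ <;> constructor <;> linarith

lemma liftsMeet_comm (u v : W) (k : ℤ) :
    LiftsMeet L x ℓ u v k ↔ LiftsMeet L x ℓ v u (-k) := by
  unfold LiftsMeet
  push_cast
  constructor <;> rintro ⟨h₁, h₂⟩ <;> constructor <;> linarith

variable [Fintype W]

open Classical in
/-- The ordered pairs of distinct vertices whose chosen lifts meet. -/
noncomputable def meetPairs (L : ℝ) (x ℓ : W → ℝ) : Finset (W × W) :=
  Finset.univ.filter fun p => p.1 ≠ p.2 ∧ LiftsMeet L x ℓ p.1 p.2 0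

open Classical in
lemma card_le_card_of_agree_off_cut (B : Finset W) (f g : W → W → Prop)
    (hf : ∀ u v, f u v ↔ f v u) (hg : ∀ u v, g u v ↔ g v u)
    (hagree : ∀ u v, (u ∈ B ↔ v ∈ B) → (f u v → g u v))
    (hcut : ∀ b ∈ B, (Finset.univ.filter fun w => w ∉ B ∧ f b w).card ≤
      (Finset.univ.filter fun w => w ∉ B ∧ g b w).card) :
    (Finset.univ.filter fun p : W × W => f p.1 p.2).card ≤
      (Finset.univ.filter fun p : W × W => g p.1 p.2).card := by
  have key : ∀ q : W → W → Prop, (∀ u v, q u v ↔ q v u) →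
      (Finset.univ.filter fun p : W × W => q p.1 p.2).card =
      (Finset.univ.filter fun p : W × W => (p.1 ∈ B ↔ p.2 ∈ B) ∧ q p.1 p.2).card +
      2 * ∑ b ∈ B, (Finset.univ.filter fun w => w ∉ B ∧ q b w).card := by
    intro q hq
    have e1 : (Finset.univ.filter fun p : W × W => p.1 ∈ B ∧ p.2 ∉ B ∧ q p.1 p.2).card =
        ∑ b ∈ B, (Finset.univ.filter fun w => w ∉ B ∧ q b w).card := by
      rw [← Finset.card_sigma]
      refine Finset.card_bij' (fun p _ => ⟨p.1, p.2⟩) (fun s _ => (s.1, s.2)) ?_ ?_ ?_ ?_ <;>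
        simp
    have e2 : (Finset.univ.filter fun p : W × W => p.1 ∉ B ∧ p.2 ∈ B ∧ q p.1 p.2).card =
        (Finset.univ.filter fun p : W × W => p.1 ∈ B ∧ p.2 ∉ B ∧ q p.1 p.2).card := by
      refine Finset.card_bij' (fun p _ => p.swap) (fun p _ => p.swap) ?_ ?_ ?_ ?_ <;>
        simp only [Finset.mem_filter, Finset.mem_univ, true_and, Prod.fst_swap, Prod.snd_swap,
          Prod.swap_swap, implies_true]
      · rintro p ⟨h1, h2, h3⟩; exact ⟨h2, h1, (hq _ _).1 h3⟩
      · rintro p ⟨h1, h2, h3⟩; exact ⟨h2, h1, (hq _ _).1 h3⟩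
    have e3 := Finset.card_filter_add_card_filter_not
      (s := Finset.univ.filter fun p : W × W => q p.1 p.2) (fun p => (p.1 ∈ B ↔ p.2 ∈ B))
    have e4 := Finset.card_filter_add_card_filter_not
      (s := Finset.univ.filter fun p : W × W => ¬ (p.1 ∈ B ↔ p.2 ∈ B) ∧ q p.1 p.2)
      (fun p => p.1 ∈ B)
    rw [Finset.filter_filter, Finset.filter_filter] at e3 e4
    have s1 : (Finset.univ.filter fun p : W × W => q p.1 p.2 ∧ (p.1 ∈ B ↔ p.2 ∈ B)) =
      Finset.univ.filter fun p : W × W => (p.1 ∈ B ↔ p.2 ∈ B) ∧ q p.1 p.2 := by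
      ext; simp; tauto
    have s2 : (Finset.univ.filter fun p : W × W => q p.1 p.2 ∧ ¬(p.1 ∈ B ↔ p.2 ∈ B)) =
      Finset.univ.filter fun p : W × W => ¬ (p.1 ∈ B ↔ p.2 ∈ B) ∧ q p.1 p.2 := by
      ext; simp; tauto
    have s3 : (Finset.univ.filter fun p : W × W =>
        (¬ (p.1 ∈ B ↔ p.2 ∈ B) ∧ q p.1 p.2) ∧ p.1 ∈ B) =
      Finset.univ.filter fun p : W × W => p.1 ∈ B ∧ p.2 ∉ B ∧ q p.1 p.2 := by
      ext; simp; tauto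
    have s4 : (Finset.univ.filter fun p : W × W =>
        (¬ (p.1 ∈ B ↔ p.2 ∈ B) ∧ q p.1 p.2) ∧ p.1 ∉ B) =
      Finset.univ.filter fun p : W × W => p.1 ∉ B ∧ p.2 ∈ B ∧ q p.1 p.2 := by
      ext; simp; tauto
    rw [s1, s2] at e3
    rw [s3, s4] at e4
    omega
  rw [key f hf, key g hg]
  have h1 := Finset.sum_le_sum hcut
  have h2 : (Finset.univ.filter fun p : W × W => (p.1 ∈ B ↔ p.2 ∈ B) ∧ f p.1 p.2).card ≤
      (Finset.univ.filter fun p : W × W => (p.1 ∈ B ↔ p.2 ∈ B) ∧ g p.1 p.2).card := by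
    apply Finset.card_le_card
    intro p
    simp only [Finset.mem_filter, Finset.mem_univ, true_and]
    exact fun h => ⟨h.1, hagree _ _ h.1 h.2⟩
  omega

open Classical in
/-- Number of left endpoints in the half-open turn `(z - L, z]`. -/
noncomputable def turnCount (L : ℝ) (x : W → ℝ) (z : ℝ) : ℕ :=
  (Finset.univ.filter fun w => z - L < x w ∧ x w ≤ z).card

open Classical in
/-- Number of left endpoints in the half-open turn `[z - L, z)`. -/
noncomputable def turnCountLeft (L : ℝ) (x : W → ℝ) (z : ℝ) : ℕ :=
  (Finset.univ.filter fun w => z - L ≤ x w ∧ x w < z).card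

/-- The count just before `θ` is attained at the last translate of a left endpoint before `θ`. -/
lemma exists_turnCount_eq_left (va : W) {θ : ℝ} (hθ : x va + L < θ) :
    ∃ z, x va + L ≤ z ∧ z < θ ∧ turnCount L x z = turnCountLeft L x θ := by
  classical
  obtain ⟨p, hp, hmax⟩ := Finset.exists_max_image
    ((Finset.univ : Finset (W × Bool)).filter fun p =>
      x p.1 + (if p.2 then L else 0) < θ) (fun p => x p.1 + (if p.2 then L else 0))
    ⟨(va, true), by simpa using hθ⟩
  simp only [Finset.mem_filter, Finset.mem_univ, true_and] at hp hmax
  refine ⟨_, ?_, hp, ?_⟩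
  · simpa using hmax (va, true) (by simpa using hθ)
  · unfold turnCount turnCountLeft
    congr 1
    ext w
    simp only [Finset.mem_filter, Finset.mem_univ, true_and]
    have h0 := hmax (w, false)
    have h1 := hmax (w, true)
    simp only [Bool.false_eq_true, if_false, if_true, add_zero] at h0 h1
    constructor
    · rintro ⟨h2, h3⟩
      refine ⟨?_, by linarith⟩
      by_contra! h
      linarith [h1 (by linarith)]
    · rintro ⟨h2, h3⟩
      exact ⟨by linarith, h0 h3⟩

/-- A turn in `[x va + L, x vb)` whose count of left endpoints is minimal. -/
lemma exists_min_turn (h : ProperLift L x ℓ) (va vb : W)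
    (hab : x va + L < x vb) :
    ∃ μ, x va + L ≤ μ ∧ μ < x vb ∧
      (∀ z, x va + L ≤ z → z ≤ x vb → turnCount L x μ ≤ turnCount L x z) ∧
      (∀ z, x va + L ≤ z → z ≤ x vb → turnCount L x μ ≤ turnCountLeft L x z) := by
  classical
  obtain ⟨μ, ⟨h1, h2⟩, hmin⟩ := WellFounded.has_min
    (InvImage.wf (turnCount L x) (wellFounded_lt (α := ℕ))) (Set.Ico (x va + L) (x vb))
    ⟨_, le_rfl, hab⟩
  simp only [InvImage, not_lt] at hmin
  have hleft : ∀ z, x va + L ≤ z → z ≤ x vb → turnCount L x μ ≤ turnCountLeft L x z := by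
    intro z hz1 hz2
    rcases hz1.eq_or_lt with rfl | hz1
    · refine (hmin _ ⟨le_rfl, hab⟩).trans (Finset.card_le_card ?_)
      intro w
      simp only [Finset.mem_filter, Finset.mem_univ, true_and]
      rintro ⟨h3, h4⟩
      refine ⟨by linarith, lt_of_le_of_ne h4 ?_⟩
      intro h5
      have := h.inj w va 1 (by push_cast; linarith)
      subst this
      linarith [h.L_pos]
    · obtain ⟨z', hz'1, hz'2, hz'⟩ := exists_turnCount_eq_left (L := L) (x := x) va hz1
      rw [← hz']
      exact hmin _ ⟨hz'1, by linarith⟩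
  refine ⟨μ, h1, h2, fun z hz1 hz2 => ?_, hleft⟩
  rcases hz2.eq_or_lt with rfl | hz2
  · refine (hleft _ hz1 le_rfl).trans (Finset.card_le_card ?_)
    intro w
    simp only [Finset.mem_filter, Finset.mem_univ, true_and]
    rintro ⟨h3, h4⟩
    refine ⟨lt_of_le_of_ne h3 ?_, h4.le⟩
    intro h5
    have := h.inj vb w 1 (by push_cast; linarith)
    subst this
    linarith [h.L_pos]
  · exact hmin _ ⟨hz1, hz2⟩


lemma card_filter_le_add {p q r : W → Prop} [DecidablePred p] [DecidablePred q]
    [DecidablePred r] (h : ∀ w, r w → p w ∨ q w) :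
    (Finset.univ.filter r).card ≤ (Finset.univ.filter p).card + (Finset.univ.filter q).card := by
  classical
  refine (Finset.card_le_card ?_).trans (Finset.card_union_le _ _)
  intro w
  simpa using h w

lemma add_le_card_filter {p q r : W → Prop} [DecidablePred p] [DecidablePred q]
    [DecidablePred r] (hp : ∀ w, p w → r w) (hq : ∀ w, q w → r w)
    (hd : ∀ w, p w → ¬ q w) :
    (Finset.univ.filter p).card + (Finset.univ.filter q).card ≤ (Finset.univ.filter r).card := by
  classical
  rw [← Finset.card_union_of_disjoint]
  · refine Finset.card_le_card ?_
    intro w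
    simp only [Finset.mem_union, Finset.mem_filter, Finset.mem_univ, true_and]
    rintro (h | h)
    · exact hp w h
    · exact hq w h
  · rw [Finset.disjoint_left]
    intro w
    simpa using hd w

lemma card_filter_eq_add {p q r : W → Prop} [DecidablePred p] [DecidablePred q]
    [DecidablePred r] (h : ∀ w, r w ↔ p w ∨ q w)
    (hd : ∀ w, p w → ¬ q w) :
    (Finset.univ.filter r).card = (Finset.univ.filter p).card + (Finset.univ.filter q).card :=
  le_antisymm (card_filter_le_add fun w => (h w).1)
    (add_le_card_filter (fun w hw => (h w).2 (Or.inl hw)) (fun w hw => (h w).2 (Or.inr hw)) hd)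

open Classical in
lemma card_le_eq_turnCount_add (hL : 0 < L) (z : ℝ) :
    (Finset.univ.filter fun w => x w ≤ z).card =
      turnCount L x z + (Finset.univ.filter fun w => x w + L ≤ z).card := by
  refine card_filter_eq_add (fun w => ⟨fun h => ?_, ?_⟩) ?_
  · by_cases h' : x w + L ≤ z
    · exact Or.inr h'
    · exact Or.inl ⟨by linarith, h⟩
  · rintro (h | h) <;> linarith
  · intro w h h'; linarith

open Classical in
lemma card_lt_eq_turnCountLeft_add (hL : 0 < L) (z : ℝ) :
    (Finset.univ.filter fun w => x w < z).card =
      turnCountLeft L x z + (Finset.univ.filter fun w => x w + L < z).card := by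
  refine card_filter_eq_add (fun w => ⟨fun h => ?_, ?_⟩) ?_
  · by_cases h' : x w + L < z
    · exact Or.inr h'
    · exact Or.inl ⟨by linarith, h⟩
  · rintro (h | h) <;> linarith
  · intro w h h'; linarith

open Classical in
lemma card_le_eq_card_lt_add (y : W → ℝ) {a b : ℝ} (hab : a ≤ b) :
    (Finset.univ.filter fun w => y w ≤ b).card =
      (Finset.univ.filter fun w => y w < a).card +
      (Finset.univ.filter fun w => a ≤ y w ∧ y w ≤ b).card := by
  refine card_filter_eq_add (fun w => ⟨fun h => ?_, ?_⟩) ?_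
  · by_cases h' : y w < a
    · exact Or.inl h'
    · exact Or.inr ⟨by linarith, h⟩
  · rintro (h | h) <;> linarith
  · intro w h h'; linarith

open Classical in
lemma card_le_eq_card_le_add (y : W → ℝ) {a b : ℝ} (hab : a ≤ b) :
    (Finset.univ.filter fun w => y w ≤ b).card =
      (Finset.univ.filter fun w => y w ≤ a).card +
      (Finset.univ.filter fun w => a < y w ∧ y w ≤ b).card := by
  refine card_filter_eq_add (fun w => ⟨fun h => ?_, ?_⟩) ?_
  · by_cases h' : y w ≤ a
    · exact Or.inl h'
    · exact Or.inr ⟨by linarith, h⟩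
  · rintro (h | h) <;> linarith
  · intro w h h'; linarith

open Classical in
lemma card_reaching_le (h : ProperLift L x ℓ) {va b : W} {μ : ℝ}
    (hP : ∀ z, x va + L ≤ z → z ≤ μ → turnCount L x μ ≤ turnCountLeft L x z) :
    (Finset.univ.filter fun w => x va + L ≤ x w ∧ x w ≤ μ ∧ x b ≤ x w + ℓ w).card ≤
      (Finset.univ.filter fun w => x w + L ≤ μ ∧ x b ≤ x w + L + ℓ w).card := by
  have hL := h.L_pos
  set pos : W × Bool → ℝ := fun p => x p.1 + (if p.2 then L else 0) with hpos
  by_cases hne : ((Finset.univ : Finset (W × Bool)).filter fun p =>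
      x va + L ≤ pos p ∧ pos p ≤ μ ∧ x b ≤ pos p + ℓ p.1).Nonempty
  swap
  · rw [Finset.not_nonempty_iff_eq_empty] at hne
    refine (Finset.card_le_card (t := ∅) ?_).trans (by simp)
    intro w hw
    simp only [Finset.mem_filter, Finset.mem_univ, true_and] at hw
    have : (w, false) ∈ ((Finset.univ : Finset (W × Bool)).filter fun p =>
      x va + L ≤ pos p ∧ pos p ≤ μ ∧ x b ≤ pos p + ℓ p.1) := by simpa [hpos] using hw
    rw [hne] at this
    simp at this
  obtain ⟨p, hp, hpmin⟩ := Finset.exists_min_image _ pos hne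
  simp only [Finset.mem_filter, Finset.mem_univ, true_and] at hp hpmin
  obtain ⟨hp1, hp2, hp3⟩ := hp
  set θ := pos p with hθ
  have reach : ∀ w (k : ℤ), θ ≤ x w + k * L → x b ≤ x w + k * L + ℓ w := by
    intro w k hk
    rcases hk.eq_or_lt with hk | hk
    · have : p.1 = w := by
        rcases hp2' : p.2 with _ | _
        · exact h.inj p.1 w k (by simpa [hθ, hpos, hp2'] using hk)
        · refine h.inj p.1 w (k - 1) ?_
          have : x p.1 + L = x w + k * L := by simpa [hθ, hpos, hp2'] using hk
          push_cast; linarith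
      rw [← hk, ← this]
      exact hp3
    · rcases hp2' : p.2 with _ | _
      · have e : θ = x p.1 := by simp [hθ, hpos, hp2']
        have := h.mono p.1 w k (by linarith)
        linarith
      · have e : θ = x p.1 + L := by simp [hθ, hpos, hp2']
        have := h.mono p.1 w (k - 1) (by push_cast; linarith)
        push_cast at this
        linarith
  have hPθ := hP θ hp1 hp2
  have i1 := card_le_eq_turnCount_add (x := x) hL μ
  have i2 := card_lt_eq_turnCountLeft_add (x := x) hL θ
  have i3 := card_le_eq_card_lt_add x hp2
  have i4 := card_le_eq_card_lt_add (fun w => x w + L) hp2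
  have i5 : (Finset.univ.filter fun w => x va + L ≤ x w ∧ x w ≤ μ ∧ x b ≤ x w + ℓ w).card ≤
      (Finset.univ.filter fun w => θ ≤ x w ∧ x w ≤ μ).card := by
    refine Finset.card_le_card ?_
    intro w
    simp only [Finset.mem_filter, Finset.mem_univ, true_and]
    intro hw
    have := hpmin (w, false) (by simpa [hpos] using hw)
    exact ⟨by simpa [hpos] using this, hw.2.1⟩
  have i6 : (Finset.univ.filter fun w => θ ≤ x w + L ∧ x w + L ≤ μ).card ≤
      (Finset.univ.filter fun w => x w + L ≤ μ ∧ x b ≤ x w + L + ℓ w).card := by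
    refine Finset.card_le_card ?_
    intro w
    simp only [Finset.mem_filter, Finset.mem_univ, true_and]
    intro hw
    have := reach w 1 (by push_cast; linarith)
    push_cast at this
    exact ⟨hw.2, by linarith⟩
  omega

open Classical in
/-- Moving `b` one turn down loses at most `β` and gains at least `γ` meetings. -/
lemma card_meet_turn_down (h : ProperLift L x ℓ) {va vb b b₀ c₀ : W} {μ : ℝ}
    (hmax : ∀ w, x w ≤ x vb) (hμb : μ < x vb)
    (hP : ∀ z, x va + L ≤ z → z ≤ μ → turnCount L x μ ≤ turnCountLeft L x z)
    (hb : μ < x b) (hb₀ : x b₀ ≤ x b) (hc₀ : x c₀ + L ≤ μ) :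
    (Finset.univ.filter fun w => x w ≤ μ ∧ LiftsMeet L x ℓ b w 0).card +
      (Finset.univ.filter fun w => x vb < x w + L ∧ x w ≤ x c₀ + ℓ c₀).card ≤
    (Finset.univ.filter fun w => x w ≤ μ ∧ LiftsMeet L x ℓ b w 1).card +
      (Finset.univ.filter fun w => x w < x va + L ∧ x b₀ ≤ x w + ℓ w).card := by
  have hL := h.L_pos
  have j1 := card_reaching_le h (b := b) hP
  have j2 : (Finset.univ.filter fun w => x w ≤ μ ∧ LiftsMeet L x ℓ b w 0).card ≤
      (Finset.univ.filter fun w => x w < x va + L ∧ x b₀ ≤ x w + ℓ w).card +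
      (Finset.univ.filter fun w => x va + L ≤ x w ∧ x w ≤ μ ∧ x b ≤ x w + ℓ w).card := by
    refine card_filter_le_add ?_
    rintro w ⟨h1, h2, h3⟩
    push_cast at h2 h3
    by_cases h' : x w < x va + L
    · exact Or.inl ⟨h', by linarith⟩
    · exact Or.inr ⟨by linarith, h1, by linarith⟩
  have j3 : (Finset.univ.filter fun w => x w + L ≤ μ ∧ x b ≤ x w + L + ℓ w).card +
      (Finset.univ.filter fun w => x vb < x w + L ∧ x w ≤ x c₀ + ℓ c₀).card ≤
      (Finset.univ.filter fun w => x w ≤ μ ∧ LiftsMeet L x ℓ b w 1).card := by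
    have hlb := h.len_pos b
    refine add_le_card_filter ?_ ?_ ?_
    · rintro w ⟨h1, h2⟩
      refine ⟨by linarith, ?_, ?_⟩ <;> push_cast <;> linarith
    · rintro w ⟨h1, h2⟩
      have h3 := h.mono c₀ b (-1) (by push_cast; linarith)
      push_cast at h3
      have h4 := h.len_lt c₀
      have h5 := h.len_pos w
      have h6 := hmax b
      refine ⟨by linarith, ?_, ?_⟩ <;> push_cast <;> linarith
    · rintro w ⟨h1, h2⟩ ⟨h3, h4⟩
      linarith
  omega

open Classical in
/-- Moving `c` one turn up loses at most `γ` and gains at least `β` meetings. -/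
lemma card_meet_turn_up (h : ProperLift L x ℓ) {va vb c b₀ c₀ : W} {μ : ℝ}
    (hmin : ∀ w, x va ≤ x w) (hμ : x va + L ≤ μ)
    (hP : ∀ z, x va + L ≤ z → z ≤ x vb → turnCount L x μ ≤ turnCount L x z)
    (hc : x c + L ≤ μ) (hb₀ : μ < x b₀) (hc₀ : x c ≤ x c₀) :
    (Finset.univ.filter fun w => μ < x w + L ∧ LiftsMeet L x ℓ c w 0).card +
      (Finset.univ.filter fun w => x w < x va + L ∧ x b₀ ≤ x w + ℓ w).card ≤
    (Finset.univ.filter fun w => μ < x w + L ∧ LiftsMeet L x ℓ c w (-1)).card +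
      (Finset.univ.filter fun w => x vb < x w + L ∧ x w ≤ x c₀ + ℓ c₀).card := by
  have hL := h.L_pos
  have hcc : x c + ℓ c ≤ x c₀ + ℓ c₀ := by
    rcases hc₀.eq_or_lt with e | e
    · rw [h.inj c c₀ 0 (by push_cast; linarith)]
    · have := h.mono c c₀ 0 (by push_cast; linarith)
      push_cast at this
      linarith
  have j1 : (Finset.univ.filter fun w =>
        μ < x w + L ∧ x w + L ≤ x vb ∧ x w ≤ x c + ℓ c).card ≤
      (Finset.univ.filter fun w => μ < x w ∧ x w ≤ x c + L + ℓ c).card := by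
    set ρ := min (x vb) (x c + L + ℓ c) with hρ
    rcases le_or_gt ρ μ with hle | hlt
    · refine (Finset.card_le_card (t := ∅) ?_).trans (by simp)
      intro w hw
      simp only [Finset.mem_filter, Finset.mem_univ, true_and] at hw
      have : x w + L ≤ ρ := le_min hw.2.1 (by linarith)
      linarith
    have hPρ := hP ρ (by linarith) (min_le_left _ _)
    have i1 := card_le_eq_turnCount_add (x := x) hL μ
    have i2 := card_le_eq_turnCount_add (x := x) hL ρ
    have i3 := card_le_eq_card_le_add x hlt.le
    have i4 := card_le_eq_card_le_add (fun w => x w + L) hlt.le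
    have i5 : (Finset.univ.filter fun w =>
          μ < x w + L ∧ x w + L ≤ x vb ∧ x w ≤ x c + ℓ c).card ≤
        (Finset.univ.filter fun w => μ < x w + L ∧ x w + L ≤ ρ).card := by
      refine Finset.card_le_card ?_
      intro w
      simp only [Finset.mem_filter, Finset.mem_univ, true_and]
      intro hw
      exact ⟨hw.1, le_min hw.2.1 (by linarith)⟩
    have i6 : (Finset.univ.filter fun w => μ < x w ∧ x w ≤ ρ).card ≤
        (Finset.univ.filter fun w => μ < x w ∧ x w ≤ x c + L + ℓ c).card := by
      refine Finset.card_le_card ?_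
      intro w
      simp only [Finset.mem_filter, Finset.mem_univ, true_and]
      intro hw
      exact ⟨hw.1, hw.2.trans (min_le_right _ _)⟩
    omega
  have j2 : (Finset.univ.filter fun w => μ < x w + L ∧ LiftsMeet L x ℓ c w 0).card ≤
      (Finset.univ.filter fun w => x vb < x w + L ∧ x w ≤ x c₀ + ℓ c₀).card +
      (Finset.univ.filter fun w =>
        μ < x w + L ∧ x w + L ≤ x vb ∧ x w ≤ x c + ℓ c).card := by
    refine card_filter_le_add ?_
    rintro w ⟨h1, h2, h3⟩
    push_cast at h2 h3
    by_cases h' : x vb < x w + L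
    · exact Or.inl ⟨h', by linarith⟩
    · exact Or.inr ⟨h1, by linarith, by linarith⟩
  have j3 : (Finset.univ.filter fun w => μ < x w ∧ x w ≤ x c + L + ℓ c).card +
      (Finset.univ.filter fun w => x w < x va + L ∧ x b₀ ≤ x w + ℓ w).card ≤
      (Finset.univ.filter fun w => μ < x w + L ∧ LiftsMeet L x ℓ c w (-1)).card := by
    have hlc := h.len_pos c
    refine add_le_card_filter ?_ ?_ ?_
    · rintro w ⟨h1, h2⟩
      have := h.len_pos w
      refine ⟨by linarith, ?_, ?_⟩ <;> push_cast <;> linarith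
    · rintro w ⟨h1, h2⟩
      have h3 := h.len_lt w
      have h4 := hmin c
      refine ⟨by linarith, ?_, ?_⟩ <;> push_cast <;> linarith
    · rintro w ⟨h1, h2⟩ ⟨h3, h4⟩
      linarith
  omega

end Exchange

section Exchange
variable {W : Type*} [Fintype W] {L : ℝ} {x ℓ : W → ℝ}

/-- Total number of full turns by which pairs of left endpoints are apart. -/
noncomputable def turnSpread (L : ℝ) (x : W → ℝ) : ℕ :=
  ∑ p : W × W, ⌊|x p.1 - x p.2| / L⌋₊

lemma turnSpread_shift_lt (hL : 0 < L) {φ : W → ℤ}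
    (hφ : ∀ u v, φ u = φ v ∨ (φ v = φ u + 1 ∧ x v < x u) ∨ (φ u = φ v + 1 ∧ x u < x v))
    {a b : W} (hab : φ a = φ b + 1) (hx : x a + L ≤ x b) :
    turnSpread L (fun v => x v + φ v * L) < turnSpread L x := by
  have key : ∀ d : ℝ, 0 < d → ⌊|d - L| / L⌋₊ ≤ ⌊|d| / L⌋₊ := by
    intro d hd
    by_cases h : d < L
    · have : ⌊|d - L| / L⌋₊ = 0 := by
        rw [Nat.floor_eq_zero, div_lt_one hL, abs_lt]
        constructor <;> linarith
      omega
    · apply Nat.floor_le_floor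
      rw [abs_of_pos hd, abs_of_nonneg (by linarith)]
      gcongr
      linarith
  have key' : ⌊|x a - x b + L| / L⌋₊ < ⌊|x a - x b| / L⌋₊ := by
    rw [abs_of_nonpos (by linarith), abs_of_neg (by linarith)]
    have e : -(x a - x b) / L = -(x a - x b + L) / L + 1 := by field_simp; ring
    rw [e, Nat.floor_add_one (div_nonneg (by linarith) hL.le)]
    omega
  unfold turnSpread
  refine Finset.sum_lt_sum (fun p _ => ?_) ⟨(a, b), Finset.mem_univ _, ?_⟩
  · rcases hφ p.1 p.2 with e | ⟨e, h⟩ | ⟨e, h⟩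
    · simp [e]
    · have := key (x p.1 - x p.2) (by linarith)
      rwa [show x p.1 - x p.2 - L = x p.1 + φ p.1 * L - (x p.2 + φ p.2 * L) by
        rw [e]; push_cast; ring] at this
    · have := key (x p.2 - x p.1) (by linarith)
      rwa [show x p.2 - x p.1 - L = x p.2 + φ p.2 * L - (x p.1 + φ p.1 * L) by
        rw [e]; push_cast; ring, abs_sub_comm, abs_sub_comm (x p.2)] at this
  · rwa [show x a - x b + L = x a + φ a * L - (x b + φ b * L) by
      rw [hab]; push_cast; ring] at key'

lemma exists_shift_turnSpread_lt (h : ProperLift L x ℓ) {va vb : W}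
    (hmin : ∀ w, x va ≤ x w) (hmax : ∀ w, x w ≤ x vb) (hab : x va + L < x vb) :
    ∃ φ : W → ℤ, turnSpread L (fun v => x v + φ v * L) < turnSpread L x ∧
      (meetPairs L x ℓ).card ≤ (meetPairs L (fun v => x v + φ v * L) ℓ).card := by
  classical
  have hL := h.L_pos
  obtain ⟨μ, hμ, hμb, hP, hP'⟩ := exists_min_turn h va vb hab
  obtain ⟨b₀, hb₀, hb₀min⟩ := Finset.exists_min_image
    (Finset.univ.filter fun w => μ < x w) x ⟨vb, by simpa using hμb⟩
  obtain ⟨c₀, hc₀, hc₀max⟩ := Finset.exists_max_image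
    (Finset.univ.filter fun w => x w + L ≤ μ) x ⟨va, by simpa using hμ⟩
  simp only [Finset.mem_filter, Finset.mem_univ, true_and] at hb₀ hb₀min hc₀ hc₀max
  have symm : ∀ (z : W → ℝ) (u v : W), (u ≠ v ∧ LiftsMeet L z ℓ u v 0) ↔
      (v ≠ u ∧ LiftsMeet L z ℓ v u 0) := by
    intro z u v
    rw [liftsMeet_comm, neg_zero, ne_comm]
  rcases le_total
    (Finset.univ.filter fun w => x w < x va + L ∧ x b₀ ≤ x w + ℓ w).card
    (Finset.univ.filter fun w => x vb < x w + L ∧ x w ≤ x c₀ + ℓ c₀).card with hβγ | hβγ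
  · refine ⟨fun v => if μ < x v then -1 else 0, ?_, ?_⟩
    · refine turnSpread_shift_lt hL (a := va) (b := vb) (fun u v => ?_) ?_ hab.le
      · by_cases hu : μ < x u <;> by_cases hv : μ < x v <;> simp [hu, hv] <;> linarith
      · have : ¬ μ < x va := by linarith
        simp [this, hμb]
    · unfold meetPairs
      convert card_le_card_of_agree_off_cut (Finset.univ.filter fun w => μ < x w)
        (fun u v => u ≠ v ∧ LiftsMeet L x ℓ u v 0)
        (fun u v => u ≠ v ∧
          LiftsMeet L (fun v => x v + ((if μ < x v then -1 else 0 : ℤ) : ℝ) * L) ℓ u v 0)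
        (symm _) (symm _) ?_ ?_
      · rintro u v huv ⟨h1, h2⟩
        simp only [Finset.mem_filter, Finset.mem_univ, true_and] at huv
        refine ⟨h1, ?_⟩
        rw [liftsMeet_shift fun v => _]
        simpa [huv] using h2
      · intro b hb
        simp only [Finset.mem_filter, Finset.mem_univ, true_and] at hb
        have := card_meet_turn_down h hmax hμb (fun z h1 h2 => hP' z h1 (by linarith)) hb
          (hb₀min b hb) hc₀
        have e : ∀ k : ℤ, ∀ q : W → Prop, (∀ w, x w ≤ μ → (q w ↔ b ≠ w ∧ LiftsMeet L x ℓ b w k)) →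
            (Finset.univ.filter fun w => w ∉ (Finset.univ.filter fun w => μ < x w) ∧ q w) =
            Finset.univ.filter fun w => x w ≤ μ ∧ LiftsMeet L x ℓ b w k := by
          intro k q hq
          ext w
          simp only [Finset.mem_filter, Finset.mem_univ, true_and, not_lt]
          refine and_congr_right fun hw => ?_
          rw [hq w hw, and_iff_right]
          rintro rfl
          linarith
        rw [e 0 _ fun w _ => Iff.rfl, e 1 _ fun w hw => ?_]
        · omega
        · rw [liftsMeet_shift fun v => _]
          simp [hb, not_lt.2 hw]
  · refine ⟨fun v => if x v + L ≤ μ then 1 else 0, ?_, ?_⟩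
    · refine turnSpread_shift_lt hL (a := va) (b := vb) (fun u v => ?_) ?_ hab.le
      · by_cases hu : x u + L ≤ μ <;> by_cases hv : x v + L ≤ μ <;> simp [hu, hv] <;> linarith
      · have : ¬ x vb + L ≤ μ := by linarith
        simp [this, hμ]
    · unfold meetPairs
      convert card_le_card_of_agree_off_cut (Finset.univ.filter fun w => x w + L ≤ μ)
        (fun u v => u ≠ v ∧ LiftsMeet L x ℓ u v 0)
        (fun u v => u ≠ v ∧
          LiftsMeet L (fun v => x v + ((if x v + L ≤ μ then 1 else 0 : ℤ) : ℝ) * L) ℓ u v 0)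
        (symm _) (symm _) ?_ ?_
      · rintro u v huv ⟨h1, h2⟩
        simp only [Finset.mem_filter, Finset.mem_univ, true_and] at huv
        refine ⟨h1, ?_⟩
        rw [liftsMeet_shift fun v => _]
        simpa [huv] using h2
      · intro c hc
        simp only [Finset.mem_filter, Finset.mem_univ, true_and] at hc
        have := card_meet_turn_up h hmin hμ hP hc hb₀ (hc₀max c hc)
        have e : ∀ k : ℤ, ∀ q : W → Prop,
            (∀ w, μ < x w + L → (q w ↔ c ≠ w ∧ LiftsMeet L x ℓ c w k)) →
            (Finset.univ.filter fun w => w ∉ (Finset.univ.filter fun w => x w + L ≤ μ) ∧ q w) =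
            Finset.univ.filter fun w => μ < x w + L ∧ LiftsMeet L x ℓ c w k := by
          intro k q hq
          ext w
          simp only [Finset.mem_filter, Finset.mem_univ, true_and, not_le]
          refine and_congr_right fun hw => ?_
          rw [hq w hw, and_iff_right]
          rintro rfl
          linarith
        rw [e 0 _ fun w _ => Iff.rfl, e (-1) _ fun w hw => ?_]
        · omega
        · rw [liftsMeet_shift fun v => _]
          simp [hc, not_le.2 hw]

/-- Some choice of lifts has all left endpoints within one turn, without losing meetings. -/
lemma exists_shift_window (h : ProperLift L x ℓ) :
    ∃ φ : W → ℤ, (∀ u v, x u + φ u * L < x v + φ v * L + L) ∧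
      (meetPairs L x ℓ).card ≤ (meetPairs L (fun v => x v + φ v * L) ℓ).card := by
  induction hn : turnSpread L x using Nat.strong_induction_on generalizing x with
  | _ n ih =>
  have hL := h.L_pos
  by_cases hw : ∀ u v, x u < x v + L
  · exact ⟨0, by simpa using hw, by simp⟩
  push Not at hw
  obtain ⟨u, v, huv⟩ := hw
  obtain ⟨va, -, hmin⟩ := Finset.exists_min_image Finset.univ x ⟨v, Finset.mem_univ _⟩
  obtain ⟨vb, -, hmax⟩ := Finset.exists_max_image Finset.univ x ⟨v, Finset.mem_univ _⟩
  have hv := hmin v (Finset.mem_univ _)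
  have hu := hmax u (Finset.mem_univ _)
  have hab : x va + L < x vb := by
    refine lt_of_le_of_ne (by linarith) fun e => ?_
    have := h.inj vb va 1 (by push_cast; linarith)
    subst this
    linarith
  obtain ⟨φ, hlt, hcard⟩ := exists_shift_turnSpread_lt h (fun w => hmin w (Finset.mem_univ _))
    (fun w => hmax w (Finset.mem_univ _)) hab
  obtain ⟨ψ, hψ, hcard'⟩ := ih _ (hn ▸ hlt) (h.shift φ) rfl
  have e : ∀ w, x w + ((φ w + ψ w : ℤ) : ℝ) * L = x w + φ w * L + ψ w * L := by
    intro w; push_cast; ring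
  refine ⟨fun w => φ w + ψ w, fun u v => ?_, ?_⟩
  · rw [e, e]; exact hψ u v
  · simp only [e]; exact hcard.trans hcard'

end Exchange

section UnitMap
variable {W : Type*} {L : ℝ} {x ℓ : W → ℝ}

lemma ProperLift.mono_zero (h : ProperLift L x ℓ) {u v : W} (huv : x u < x v) :
    x u + ℓ u < x v + ℓ v := by
  simpa using h.mono u v 0 (by simpa using huv)

lemma ProperLift.injective (h : ProperLift L x ℓ) : Function.Injective x :=
  fun u v huv => h.inj u v 0 (by simpa using huv)

lemma liftsMeet_zero_iff_of_lt (h : ProperLift L x ℓ) {u v : W} (huv : x u < x v) :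
    LiftsMeet L x ℓ u v 0 ↔ x v ≤ x u + ℓ u := by
  have := h.len_pos v
  simp only [LiftsMeet, Int.cast_zero, zero_mul, add_zero, and_iff_right_iff_imp]
  intro; linarith

/-- Proper intervals can be stretched to unit intervals with the same intersections. -/
lemma exists_unit_map [Fintype W] (h : ProperLift L x ℓ) :
    ∃ f : W → ℝ, ∀ u v, u ≠ v → (LiftsMeet L x ℓ u v 0 ↔ |f u - f v| ≤ 1) := by
  classical
  have key : ∀ s : Finset W, ∃ f : W → ℝ, ∀ u ∈ s, ∀ v ∈ s, x u < x v →
      f u < f v ∧ (x v ≤ x u + ℓ u → f v < f u + 1) ∧ (x u + ℓ u < x v → f u + 1 < f v) := by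
    intro s
    induction s using Finset.induction_on_max_value x with
    | empty => simp
    | insert a s ha hmax ih =>
      obtain ⟨f, hf⟩ := ih
      have hlt : ∀ w ∈ s, x w < x a := fun w hw =>
        lt_of_le_of_ne (hmax w hw) fun e => ha (h.injective e ▸ hw)
      obtain ⟨t, ht1, ht2⟩ := Order.exists_between_finsets
        (s.image f ∪ (s.filter fun w => x w + ℓ w < x a).image fun w => f w + 1)
        ((s.filter fun w => x a ≤ x w + ℓ w).image fun w => f w + 1) (by
          intro p hp q hq
          simp only [Finset.mem_union, Finset.mem_image, Finset.mem_filter] at hp hq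
          obtain ⟨w', ⟨hw', h1⟩, rfl⟩ := hq
          rcases hp with ⟨w, hw, rfl⟩ | ⟨w, ⟨hw, h2⟩, rfl⟩
          · rcases lt_trichotomy (x w) (x w') with e | e | e
            · linarith [(hf w hw w' hw' e).1]
            · rw [h.injective e]; linarith
            · exact (hf w' hw' w hw e).2.1 ((hlt w hw).le.trans h1)
          · have : x w < x w' := by
              by_contra hc
              rcases (not_lt.1 hc).eq_or_lt with e | e
              · rw [h.injective e] at h1; linarith
              · linarith [h.mono_zero e]
            linarith [(hf w hw w' hw' this).1])
      simp only [Finset.mem_union, Finset.mem_image, Finset.mem_filter] at ht1 ht2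
      refine ⟨Function.update f a t, ?_⟩
      have hne : ∀ w ∈ s, Function.update f a t w = f w := fun w hw =>
        Function.update_of_ne (by rintro rfl; exact ha hw) _ _
      intro u hu v hv huv
      rcases Finset.mem_insert.1 hu with rfl | hu' <;> rcases Finset.mem_insert.1 hv with rfl | hv'
      · exact absurd huv (lt_irrefl _)
      · exact absurd huv (hlt v hv').not_gt
      · rw [Function.update_self, hne u hu']
        exact ⟨ht1 _ (Or.inl ⟨u, hu', rfl⟩), fun h1 => ht2 _ ⟨u, ⟨hu', h1⟩, rfl⟩,
          fun h1 => ht1 _ (Or.inr ⟨u, ⟨hu', h1⟩, rfl⟩)⟩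
      · rw [hne u hu', hne v hv']
        exact hf u hu' v hv' huv
  obtain ⟨f, hf⟩ := key Finset.univ
  have main : ∀ u v, x u < x v → (LiftsMeet L x ℓ u v 0 ↔ |f u - f v| ≤ 1) := by
    intro u v huv
    obtain ⟨h1, h2, h3⟩ := hf u (Finset.mem_univ _) v (Finset.mem_univ _) huv
    rw [liftsMeet_zero_iff_of_lt h huv, abs_of_neg (by linarith)]
    constructor
    · intro h4; linarith [h2 h4]
    · intro h4
      by_contra h5
      linarith [h3 (not_le.1 h5)]
  refine ⟨f, fun u v huv => ?_⟩
  rcases lt_trichotomy (x u) (x v) with e | e | e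
  · exact main u v e
  · exact absurd (h.injective e) huv
  · rw [liftsMeet_comm, neg_zero, abs_sub_comm]
    exact main v u e

end UnitMap

/-- The point `z` of the line lies in some translate of the lift of `v`. -/
def LiftMem {V : Type*} (L : ℝ) (x ℓ : V → ℝ) (v : V) (z : ℝ) : Prop :=
  ∃ k : ℤ, x v + k * L ≤ z ∧ z ≤ x v + k * L + ℓ v

lemma liftMem_shift {V : Type*} {L : ℝ} {x ℓ : V → ℝ} (φ : V → ℤ) (v : V) (z : ℝ) :
    LiftMem L (fun v => x v + φ v * L) ℓ v z ↔ LiftMem L x ℓ v z := by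
  constructor
  · rintro ⟨k, h1, h2⟩
    exact ⟨k + φ v, by push_cast; linarith, by push_cast; linarith⟩
  · rintro ⟨k, h1, h2⟩
    exact ⟨k - φ v, by push_cast; linarith, by push_cast; linarith⟩

/-- Three pairwise intersecting arcs have a common point. -/
def TripleHelly {V : Type*} (L : ℝ) (x ℓ : V → ℝ) : Prop :=
  ∀ u v w, (∃ k, LiftsMeet L x ℓ u v k) → (∃ k, LiftsMeet L x ℓ u w k) →
    (∃ k, LiftsMeet L x ℓ v w k) → ∃ z, LiftMem L x ℓ u z ∧ LiftMem L x ℓ v z ∧ LiftMem L x ℓ w z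

namespace PreArcModel

variable {V : Type*} (A : PreArcModel V)

lemma coe_eq_coe_iff {L : ℝ} {y z : ℝ} :
    ((y : ℝ) : AddCircle L) = (z : AddCircle L) ↔ ∃ k : ℤ, z = y + k * L := by
  rw [eq_comm, ← sub_eq_zero, ← AddCircle.coe_sub, AddCircle.coe_eq_zero_iff]
  simp only [zsmul_eq_mul]
  constructor <;> rintro ⟨k, hk⟩ <;> exact ⟨k, by linarith⟩

lemma mem_arc_iff (v : V) (z : ℝ) :
    (z : AddCircle A.L) ∈ A.arc v ↔ LiftMem A.L A.src A.len v z := by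
  simp only [arc, Set.mem_image, Set.mem_Icc, coe_eq_coe_iff]
  constructor
  · rintro ⟨y, ⟨h1, h2⟩, k, rfl⟩
    exact ⟨k, by linarith, by linarith⟩
  · rintro ⟨k, h1, h2⟩
    exact ⟨z - k * A.L, ⟨by linarith, by linarith⟩, k, by ring⟩

lemma arc_inter_arc_nonempty_iff (u v : V) :
    (A.arc u ∩ A.arc v).Nonempty ↔ ∃ k, LiftsMeet A.L A.src A.len u v k := by
  constructor
  · rintro ⟨α, hu, hv⟩
    obtain ⟨z, rfl⟩ := QuotientAddGroup.mk_surjective α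
    obtain ⟨i, h1, h2⟩ := (A.mem_arc_iff u z).1 hu
    obtain ⟨j, h3, h4⟩ := (A.mem_arc_iff v z).1 hv
    refine ⟨j - i, ?_, ?_⟩ <;> push_cast <;> linarith
  · rintro ⟨k, h1, h2⟩
    have hu := A.len_pos u
    have hv := A.len_pos v
    refine ⟨((max (A.src u) (A.src v + k * A.L) : ℝ) : AddCircle A.L),
      (A.mem_arc_iff _ _).2 ⟨0, ?_, ?_⟩, (A.mem_arc_iff _ _).2 ⟨k, le_max_right _ _, ?_⟩⟩
    · simp
    · simp only [Int.cast_zero, zero_mul, add_zero, max_le_iff]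
      constructor <;> linarith
    · simp only [max_le_iff]
      constructor <;> linarith

lemma properLift (hp : A.Proper) (hd : A.EndpointsDistinct) :
    ProperLift A.L A.src A.len where
  L_pos := A.L_pos
  len_pos := A.len_pos
  len_lt := A.len_lt
  mono u v k hk := by
    by_contra hc
    rw [not_lt] at hc
    have hL := A.L_pos
    have hsub : A.arc v ⊆ A.arc u := by
      intro α hα
      obtain ⟨z, rfl⟩ := QuotientAddGroup.mk_surjective α
      obtain ⟨j, h1, h2⟩ := (A.mem_arc_iff v z).1 hα
      refine (A.mem_arc_iff u z).2 ⟨j - k, ?_, ?_⟩ <;> push_cast <;> linarith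
    have hsub' : A.arc u ⊆ A.arc v := by
      by_contra h
      exact hp v u ⟨hsub, h⟩
    obtain ⟨j, h1, h2⟩ := (A.mem_arc_iff v (A.src u)).1
      (hsub' ((A.mem_arc_iff u _).2 ⟨0, by simp, by simpa using (A.len_pos u).le⟩))
    have hjk : j < k := by
      have : (j : ℝ) * A.L < k * A.L := by linarith
      exact_mod_cast lt_of_mul_lt_mul_right this hL.le
    have : ((j : ℝ) + 1) * A.L ≤ k * A.L := by
      gcongr
      exact_mod_cast hjk
    linarith [A.len_lt u]
  inj u v k hk := by
    have : A.ccp v = A.ccp u := coe_eq_coe_iff.2 ⟨k, hk⟩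
    simpa using (@hd (v, false) (u, false) (by simpa using this)).symm

lemma tripleHelly (hh : A.Helly) : TripleHelly A.L A.src A.len := by
  intro u v w huv huw hvw
  have refl : ∀ a, (A.arc a ∩ A.arc a).Nonempty := fun a => by
    rw [Set.inter_self]
    exact ⟨_, _, Set.left_mem_Icc.2 (by linarith [A.len_pos a]), rfl⟩
  simp only [← A.arc_inter_arc_nonempty_iff] at huv huw hvw
  obtain ⟨α, hα⟩ := hh {u, v, w} (by
    rintro a (rfl | rfl | rfl) b (rfl | rfl | rfl) <;>
      first | exact refl _ | assumption | (rw [Set.inter_comm]; assumption))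
  obtain ⟨z, rfl⟩ := QuotientAddGroup.mk_surjective α
  simp only [Set.mem_iInter] at hα
  exact ⟨z, (A.mem_arc_iff _ _).1 (hα u (by simp)), (A.mem_arc_iff _ _).1 (hα v (by simp)),
    (A.mem_arc_iff _ _).1 (hα w (by simp))⟩

end PreArcModel

section UniqueOffset

variable {V : Type*} {L : ℝ} {x ℓ : V → ℝ}

lemma int_lt_of_mul_lt (hL : 0 < L) {j m : ℤ} (h : (j : ℝ) * L < m * L) : j < m := by
  exact_mod_cast lt_of_mul_lt_mul_right h hL.le

lemma liftMem_of_eq_of_mem {v : V} {z p q : ℝ} {j : ℤ} (hp : p = x v + j * L) (hq : q = p + ℓ v)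
    (hL : 0 < L) (h : LiftMem L x ℓ v z) (h₁ : z < p + L) (h₂ : q < z + L) : p ≤ z ∧ z ≤ q := by
  obtain ⟨k, h3, h4⟩ := h
  have e1 : k < j + 1 := int_lt_of_mul_lt hL (by push_cast; linarith)
  have e2 : j < k + 1 := int_lt_of_mul_lt hL (by push_cast; linarith)
  obtain rfl : k = j := by omega
  constructor <;> linarith

/-- Two arcs covering the circle force the arcs through the two overlaps to behave like two
cliques without an induced four-cycle between them. -/
lemma no_induced_four_cycle_of_cover (h : ProperLift L x ℓ) (h3 : TripleHelly L x ℓ) {u v : V}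
    {m : ℤ} (hc : x v + m * L ≤ x u + ℓ u) (hd : x u + L ≤ x v + m * L + ℓ v)
    {s p q r : V}
    (hs : ∃ j : ℤ, x s + j * L ≤ x v + m * L ∧ x u + ℓ u ≤ x s + j * L + ℓ s)
    (hp : ∃ j : ℤ, x p + j * L ≤ x v + m * L ∧ x u + ℓ u ≤ x p + j * L + ℓ p)
    (hq : ∃ j : ℤ, x q + j * L ≤ x u + L ∧ x v + m * L + ℓ v ≤ x q + j * L + ℓ q)
    (hr : ∃ j : ℤ, x r + j * L ≤ x u + L ∧ x v + m * L + ℓ v ≤ x r + j * L + ℓ r)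
    (hpq : ∃ k, LiftsMeet L x ℓ p q k) (hpr : ¬ ∃ k, LiftsMeet L x ℓ p r k)
    (hsq : ¬ ∃ k, LiftsMeet L x ℓ s q k) : False := by
  have hL := h.L_pos
  have hu := h.len_lt u
  have hv := h.len_lt v
  have hu' := h.len_pos u
  have hv' := h.len_pos v
  obtain ⟨js, hs1, hs2⟩ := hs
  obtain ⟨jp, hp1, hp2⟩ := hp
  obtain ⟨jq, hq1, hq2⟩ := hq
  obtain ⟨jr, hr1, hr2⟩ := hr
  have meet : ∀ (a b : V) (i j k : ℤ), x a + i * L + k * L ≤ x b + j * L + ℓ b →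
      x b + j * L ≤ x a + i * L + ℓ a + k * L → ∃ k, LiftsMeet L x ℓ a b k := by
    intro a b i j k h1 h2
    refine ⟨j - i - k, ?_, ?_⟩ <;> push_cast <;> linarith
  have p_lt : x p + jp * L + ℓ p < x u + L := by
    by_contra hcon
    exact hpr (meet p r jp jr 0 (by push_cast; linarith) (by push_cast; linarith))
  have lt_p : x v + m * L + ℓ v < x p + jp * L + L := by
    by_contra hcon
    exact hpr (meet p r jp jr 1 (by push_cast; linarith) (by push_cast; linarith))
  have lt_q : x u + ℓ u < x q + jq * L := by
    by_contra hcon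
    exact hsq (meet s q js jq 0 (by push_cast; linarith) (by push_cast; linarith))
  have s_lt : x s + js * L + ℓ s < x q + jq * L := by
    by_contra hcon
    exact hsq (meet s q js jq 0 (by push_cast; linarith) (by push_cast; linarith))
  have lt_s : x q + jq * L + ℓ q < x s + js * L + L := by
    by_contra hcon
    exact hsq (meet s q js jq 1 (by push_cast; linarith) (by push_cast; linarith))
  have q_lt : x q + jq * L + ℓ q < x v + m * L + L := by linarith
  have e1 : x p + jp * L + L ≤ x q + jq * L + ℓ q := by
    obtain ⟨z, hzu, hzp, hzq⟩ := h3 u p q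
      (meet u p 0 jp 0 (by push_cast; linarith) (by push_cast; linarith))
      (meet u q 0 jq 1 (by push_cast; linarith) (by push_cast; linarith)) hpq
    obtain ⟨i, hz1, hz2⟩ := hzu
    have hzp' : LiftMem L x ℓ p (z - i * L) := by
      obtain ⟨k, h1, h2⟩ := hzp
      exact ⟨k - i, by push_cast; linarith, by push_cast; linarith⟩
    have hzq' : LiftMem L x ℓ q (z - i * L) := by
      obtain ⟨k, h1, h2⟩ := hzq
      exact ⟨k - i, by push_cast; linarith, by push_cast; linarith⟩
    have f1 := liftMem_of_eq_of_mem (j := jp) rfl rfl hL hzp' (by linarith) (by linarith)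
    have f2 := liftMem_of_eq_of_mem (j := jq - 1) rfl rfl hL hzq'
      (by push_cast; linarith) (by push_cast; linarith)
    push_cast at f2
    linarith [f1.1, f2.2]
  have e2 : x q + jq * L ≤ x p + jp * L + ℓ p := by
    obtain ⟨z, hzv, hzp, hzq⟩ := h3 v p q
      (meet v p m jp 0 (by push_cast; linarith) (by push_cast; linarith))
      (meet v q m jq 0 (by push_cast; linarith) (by push_cast; linarith)) hpq
    obtain ⟨i, hz1, hz2⟩ := hzv
    have hzp' : LiftMem L x ℓ p (z - i * L + m * L) := by
      obtain ⟨k, h1, h2⟩ := hzp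
      exact ⟨k - i + m, by push_cast; linarith, by push_cast; linarith⟩
    have hzq' : LiftMem L x ℓ q (z - i * L + m * L) := by
      obtain ⟨k, h1, h2⟩ := hzq
      exact ⟨k - i + m, by push_cast; linarith, by push_cast; linarith⟩
    have f1 := liftMem_of_eq_of_mem (j := jp) rfl rfl hL hzp' (by linarith) (by linarith)
    have f2 := liftMem_of_eq_of_mem (j := jq) rfl rfl hL hzq' (by linarith) (by linarith)
    linarith [f1.2, f2.1]
  have := h.mono p s (js - jp) (by push_cast; linarith)
  push_cast at this
  linarith

/-- `x, ℓ` describe a family of arcs whose intersection graph has a hole. -/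
def HasHoleLift (L : ℝ) (x ℓ : V → ℝ) : Prop :=
  ∃ (n : ℕ) (f : ZMod n → V), 4 ≤ n ∧ ∀ i j : ZMod n, i ≠ j →
    ((∃ k, LiftsMeet L x ℓ (f i) (f j) k) ↔ (i = j + 1 ∨ j = i + 1))

/-- In the presence of a hole no two arcs of a proper Helly model cover the circle. -/
lemma not_cover_of_hasHoleLift (h : ProperLift L x ℓ) (h3 : TripleHelly L x ℓ)
    (hh : HasHoleLift L x ℓ) {u v : V} {m : ℤ} (hc : x v + m * L ≤ x u + ℓ u)
    (hd : x u + L ≤ x v + m * L + ℓ v) : False := by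
  have hL := h.L_pos
  have hu := h.len_lt u
  have hv := h.len_lt v
  obtain ⟨n, f, hn, hf⟩ := hh
  set C₁ : V → Prop := fun w =>
    ∃ j : ℤ, x w + j * L ≤ x v + m * L ∧ x u + ℓ u ≤ x w + j * L + ℓ w with hC₁
  set C₂ : V → Prop := fun w =>
    ∃ j : ℤ, x w + j * L ≤ x u + L ∧ x v + m * L + ℓ v ≤ x w + j * L + ℓ w with hC₂
  have hcl : ∀ w, C₁ w ∨ C₂ w := by
    intro w
    obtain ⟨j, ⟨hj1, hj2⟩, -⟩ := existsUnique_add_zsmul_mem_Ico hL (x w) (x u)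
    rw [zsmul_eq_mul] at hj1 hj2
    by_cases hw : x w + j * L ≤ x v + m * L
    · refine Or.inl ⟨j, hw, ?_⟩
      rcases hj1.eq_or_lt with e | e
      · rw [← e, h.inj u w j e]
      · exact (h.mono u w j e).le
    · refine Or.inr ⟨j, hj2.le, ?_⟩
      have := h.mono v w (j - m) (by push_cast; linarith)
      push_cast at this
      linarith
  have hcl₁ : ∀ w w', C₁ w → C₁ w' → ∃ k, LiftsMeet L x ℓ w w' k := by
    rintro w w' ⟨i, h1, h2⟩ ⟨j, h3, h4⟩
    refine ⟨j - i, ?_, ?_⟩ <;> push_cast <;> linarith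
  have hcl₂ : ∀ w w', C₂ w → C₂ w' → ∃ k, LiftsMeet L x ℓ w w' k := by
    rintro w w' ⟨i, h1, h2⟩ ⟨j, h3, h4⟩
    refine ⟨j - i, ?_, ?_⟩ <;> push_cast <;> linarith
  have hg : ∀ i j : ℕ, i < n → j < n → i ≠ j →
      ((∃ k, LiftsMeet L x ℓ (f i) (f j) k) ↔ (i = (j + 1) % n ∨ j = (i + 1) % n)) := by
    intro i j hi hj hij
    have cast : ∀ a b : ℕ, a < n → ((a : ZMod n) = b ↔ a = b % n) := fun a b ha => by
      rw [ZMod.natCast_eq_natCast_iff', Nat.mod_eq_of_lt ha]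
    rw [hf i j (fun e => hij (by rwa [cast _ _ hi, Nat.mod_eq_of_lt hj] at e)),
      ← cast _ _ hi, ← cast _ _ hj]
    push_cast
    rfl
  have sep : ∀ i j : ℕ, i < n → j < n → i ≠ j → i ≠ (j + 1) % n → j ≠ (i + 1) % n →
      (¬ ∃ k, LiftsMeet L x ℓ (f i) (f j) k) ∧
      (C₁ (f i) ∧ C₂ (f j) ∨ C₂ (f i) ∧ C₁ (f j)) := by
    intro i j hi hj hij h1 h2
    have hno : ¬ ∃ k, LiftsMeet L x ℓ (f i) (f j) k := by
      rw [hg i j hi hj hij]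
      exact fun e => e.elim h1 h2
    refine ⟨hno, ?_⟩
    rcases hcl (f i) with ci | ci <;> rcases hcl (f j) with cj | cj
    · exact absurd (hcl₁ _ _ ci cj) hno
    · exact Or.inl ⟨ci, cj⟩
    · exact Or.inr ⟨ci, cj⟩
    · exact absurd (hcl₂ _ _ ci cj) hno
  have sep' : ∀ i j : ℕ, i < n → j < n → i ≠ j → i ≠ (j + 1) % n → j ≠ (i + 1) % n →
      ¬ (C₁ (f i) ∧ C₁ (f j)) ∧ ¬ (C₂ (f i) ∧ C₂ (f j)) := by
    intro i j hi hj hij h1 h2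
    have hno := (sep i j hi hj hij h1 h2).1
    exact ⟨fun hh => hno (hcl₁ _ _ hh.1 hh.2), fun hh => hno (hcl₂ _ _ hh.1 hh.2)⟩
  rcases hn.eq_or_lt with rfl | hn5
  · have four : ∀ s p q r : ℕ, s < 4 → p < 4 → q < 4 → r < 4 → p = (s + 1) % 4 →
        q = (p + 1) % 4 → r = (q + 1) % 4 →
        C₁ (f s) → C₁ (f p) → C₂ (f q) → C₂ (f r) → False := by
      intro s p q r hs hp hq hr e1 e2 e3 c1 c2 c3 c4
      refine no_induced_four_cycle_of_cover h h3 hc hd c1 c2 c3 c4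
        ((hg p q hp hq (by omega)).2 (by omega))
        (sep p r hp hr (by omega) (by omega) (by omega)).1
        (sep s q hs hq (by omega) (by omega) (by omega)).1
    have s1 := (sep 0 2 (by norm_num) (by norm_num) (by norm_num) (by norm_num) (by norm_num)).2
    have s2 := (sep 1 3 (by norm_num) (by norm_num) (by norm_num) (by norm_num) (by norm_num)).2
    have f0 := four 0 1 2 3 (by norm_num) (by norm_num) (by norm_num) (by norm_num) rfl rfl rfl
    have f1 := four 1 2 3 0 (by norm_num) (by norm_num) (by norm_num) (by norm_num) rfl rfl rfl
    have f2 := four 2 3 0 1 (by norm_num) (by norm_num) (by norm_num) (by norm_num) rfl rfl rfl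
    have f3 := four 3 0 1 2 (by norm_num) (by norm_num) (by norm_num) (by norm_num) rfl rfl rfl
    clear hcl hcl₁ hcl₂ sep sep' hg four
    clear_value C₁ C₂
    tauto
  · have md : ∀ i, i < 5 → i % n = i := fun i hi => Nat.mod_eq_of_lt (by omega)
    have md' : (4 + 1) % n = 0 ∨ (4 + 1) % n = 5 := by
      rcases eq_or_ne n 5 with rfl | e
      · exact Or.inl rfl
      · exact Or.inr (Nat.mod_eq_of_lt (by omega))
    have s02 := sep' 0 2 (by omega) (by omega) (by omega) (by simp [md]) (by simp [md])
    have s24 := sep' 2 4 (by omega) (by omega) (by omega)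
      (by rcases md' with e | e <;> rw [e] <;> omega) (by simp [md])
    have s41 := sep' 4 1 (by omega) (by omega) (by omega) (by simp [md])
      (by rcases md' with e | e <;> rw [e] <;> omega)
    have s13 := sep' 1 3 (by omega) (by omega) (by omega) (by simp [md]) (by simp [md])
    have s30 := sep' 3 0 (by omega) (by omega) (by omega) (by simp [md]) (by simp [md])
    rcases hcl (f (0 : ℕ)) with c0 | c0
    · have c2 := (hcl (f (2 : ℕ))).resolve_left fun c => s02.1 ⟨c0, c⟩
      have c4 := (hcl (f (4 : ℕ))).resolve_right fun c => s24.2 ⟨c2, c⟩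
      have c1 := (hcl (f (1 : ℕ))).resolve_left fun c => s41.1 ⟨c4, c⟩
      have c3 := (hcl (f (3 : ℕ))).resolve_right fun c => s13.2 ⟨c1, c⟩
      exact s30.1 ⟨c3, c0⟩
    · have c2 := (hcl (f (2 : ℕ))).resolve_right fun c => s02.2 ⟨c0, c⟩
      have c4 := (hcl (f (4 : ℕ))).resolve_left fun c => s24.1 ⟨c2, c⟩
      have c1 := (hcl (f (1 : ℕ))).resolve_right fun c => s41.2 ⟨c4, c⟩
      have c3 := (hcl (f (3 : ℕ))).resolve_left fun c => s13.1 ⟨c1, c⟩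
      exact s30.2 ⟨c3, c0⟩

lemma liftsMeet_offset_unique (h : ProperLift L x ℓ) (h3 : TripleHelly L x ℓ)
    (hh : HasHoleLift L x ℓ) {u v : V} {k k' : ℤ} (hk : LiftsMeet L x ℓ u v k)
    (hk' : LiftsMeet L x ℓ u v k') : k = k' := by
  have key : ∀ {k k' : ℤ}, LiftsMeet L x ℓ u v k → LiftsMeet L x ℓ u v k' → ¬ k < k' := by
    rintro k k' ⟨h1, h2⟩ ⟨h4, h5⟩ hlt
    have : ((k : ℝ) + 1) * L ≤ k' * L := by
      have := h.L_pos
      gcongr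
      exact_mod_cast hlt
    exact not_cover_of_hasHoleLift h h3 hh (u := u) (v := v) (m := k + 1)
      (by push_cast; linarith) (by push_cast; linarith)
  exact le_antisymm (not_lt.1 (key hk' hk)) (not_lt.1 (key hk hk'))

lemma liftsMeet_triangle (h : ProperLift L x ℓ) (h3 : TripleHelly L x ℓ)
    (hh : HasHoleLift L x ℓ) {u v w : V} {a b c : ℤ} (huv : LiftsMeet L x ℓ u v a)
    (huw : LiftsMeet L x ℓ u w b) (hvw : LiftsMeet L x ℓ v w c) : c = b - a := by
  obtain ⟨z, ⟨i, h1, h2⟩, ⟨j, h4, h5⟩, ⟨l, h6, h7⟩⟩ := h3 u v w ⟨a, huv⟩ ⟨b, huw⟩ ⟨c, hvw⟩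
  have e1 := liftsMeet_offset_unique h h3 hh huv (k' := j - i)
    ⟨by push_cast; linarith, by push_cast; linarith⟩
  have e2 := liftsMeet_offset_unique h h3 hh huw (k' := l - i)
    ⟨by push_cast; linarith, by push_cast; linarith⟩
  have e3 := liftsMeet_offset_unique h h3 hh hvw (k' := l - j)
    ⟨by push_cast; linarith, by push_cast; linarith⟩
  omega

end UniqueOffset

section Cut

variable {W : Type*} {L : ℝ} {x ℓ : W → ℝ}

lemma ProperLift.comp {V : Type*} {x ℓ : V → ℝ} (h : ProperLift L x ℓ) {g : W → V}
    (hg : Function.Injective g) : ProperLift L (fun w => x (g w)) (fun w => ℓ (g w)) where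
  L_pos := h.L_pos
  len_pos _ := h.len_pos _
  len_lt _ := h.len_lt _
  mono _ _ k hk := h.mono _ _ k hk
  inj _ _ k hk := hg (h.inj _ _ k hk)

/-- The edges of a unit interval subgraph can be realized by intersections of suitable lifts. -/
lemma exists_shift_realizing [Fintype W] (H : SimpleGraph W) {f : W → ℝ}
    (hf : ∀ u v, u ≠ v → (H.Adj u v ↔ |f u - f v| ≤ 1))
    (hmeet : ∀ u v, H.Adj u v → ∃ k, LiftsMeet L x ℓ u v k)
    (htri : ∀ (u v w : W) (a b c : ℤ), LiftsMeet L x ℓ u v a → LiftsMeet L x ℓ u w b →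
      LiftsMeet L x ℓ v w c → c = b - a) :
    ∃ φ : W → ℤ, ∀ u v, H.Adj u v → LiftsMeet L (fun w => x w + φ w * L) ℓ u v 0 := by
  classical
  simp only [liftsMeet_shift, zero_add]
  have key : ∀ s : Finset W, ∃ φ : W → ℤ, ∀ u ∈ s, ∀ v ∈ s, H.Adj u v →
      LiftsMeet L x ℓ u v (φ v - φ u) := by
    intro s
    induction s using Finset.induction_on_max_value f with
    | empty => simp
    | insert a s ha hmax ih =>
      obtain ⟨φ, hφ⟩ := ih
      have hψ : ∃ t : ℤ, ∀ c ∈ s, H.Adj c a → LiftsMeet L x ℓ c a (t - φ c) := by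
        by_cases hb : ∃ b ∈ s, H.Adj b a
        · obtain ⟨b, hb, hba⟩ := hb
          obtain ⟨k, hk⟩ := hmeet b a hba
          refine ⟨k + φ b, fun c hc hca => ?_⟩
          by_cases hbc : b = c
          · subst hbc
            simpa using hk
          · obtain ⟨m, hm⟩ := hmeet c a hca
            have h1 := (hf b a hba.ne).1 hba
            have h2 := (hf c a hca.ne).1 hca
            have h3 := hmax b hb
            have h4 := hmax c hc
            rw [abs_le] at h1 h2
            have hadj := (hf b c hbc).2 (by rw [abs_le]; constructor <;> linarith)
            have := htri b c a _ _ _ (hφ b hb c hc hadj) hk hm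
            rwa [show k + φ b - φ c = m by omega]
        · exact ⟨0, fun c hc hca => absurd ⟨c, hc, hca⟩ hb⟩
      obtain ⟨t, ht⟩ := hψ
      have hne : ∀ w ∈ s, Function.update φ a t w = φ w := fun w hw =>
        Function.update_of_ne (by rintro rfl; exact ha hw) _ _
      refine ⟨Function.update φ a t, fun u hu v hv huv => ?_⟩
      rcases Finset.mem_insert.1 hu with e | hu' <;> rcases Finset.mem_insert.1 hv with e' | hv'
      · exact absurd (e.trans e'.symm) huv.ne
      · rw [e] at huv ⊢
        rw [Function.update_self, hne v hv', liftsMeet_comm, neg_sub]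
        exact ht v hv' huv.symm
      · rw [e'] at huv ⊢
        rw [Function.update_self, hne u hu']
        exact ht u hu' huv
      · rw [hne u hu', hne v hv']
        exact hφ u hu' v hv' huv
  obtain ⟨φ, hφ⟩ := key Finset.univ
  exact ⟨φ, fun u v => hφ u (Finset.mem_univ _) v (Finset.mem_univ _)⟩

lemma card_meetPairs [Fintype W] (L : ℝ) (x ℓ : W → ℝ)
    [DecidablePred fun p : W × W => p.1 ≠ p.2 ∧ LiftsMeet L x ℓ p.1 p.2 0] :
    (meetPairs L x ℓ).card =
      (Finset.univ.filter fun p : W × W => p.1 ≠ p.2 ∧ LiftsMeet L x ℓ p.1 p.2 0).card := by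
  unfold meetPairs
  congr!

lemma liftMem_top_iff (h : ProperLift L x ℓ) {m : W} (hwin : ∀ u v, x u < x v + L)
    (hm : ∀ w, x w ≤ x m) (v : W) : LiftMem L x ℓ v (x m) ↔ x m ≤ x v + ℓ v := by
  have hv := hm v
  have := h.len_lt v
  constructor
  · intro hmem
    have := liftMem_of_eq_of_mem (j := 0) rfl rfl h.L_pos hmem
      (by simpa using hwin m v) (by push_cast; linarith)
    simpa using this.2
  · intro hle
    exact ⟨0, by simpa using hv, by simpa using hle⟩

/-- Cutting at the last left endpoint of a one-turn window deletes exactly the intersections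
that are not seen by the chosen lifts. -/
lemma crosses_top_iff (h : ProperLift L x ℓ) {m : W} (hwin : ∀ u v, x u < x v + L)
    (hm : ∀ w, x w ≤ x m)
    (huniq : ∀ (u v : W) (k k' : ℤ), LiftsMeet L x ℓ u v k → LiftsMeet L x ℓ u v k' → k = k')
    {u v : W} {k : ℤ} (hk : LiftsMeet L x ℓ v u k) :
    (LiftMem L x ℓ v (x m) ∧ ¬ LiftMem L x ℓ u (x m) ∧ LiftMem L x ℓ u (x v + ℓ v)) ↔ k = 1 := by
  have hL := h.L_pos
  have hu := h.len_lt u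
  have hv := h.len_lt v
  have hvp := h.len_pos v
  have huv := hwin u v
  have hvu := hwin v u
  have hmu := hwin m u
  have hmv := hm v
  have hmu' := hm u
  rw [liftMem_top_iff h hwin hm, liftMem_top_iff h hwin hm]
  constructor
  · rintro ⟨h1, h2, j, h3, h4⟩
    have hj : LiftsMeet L x ℓ v u j := ⟨by linarith, by linarith⟩
    obtain rfl := huniq _ _ _ _ hk hj
    have e1 : 0 < k := by
      by_contra hcon
      have : (k : ℝ) * L ≤ 0 := mul_nonpos_of_nonpos_of_nonneg (by exact_mod_cast not_lt.1 hcon) hL.le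
      linarith
    have e2 : k < 2 := int_lt_of_mul_lt hL (by push_cast; linarith)
    omega
  · rintro rfl
    obtain ⟨h1, h2⟩ := hk
    have h1' := h1
    have h2' := h2
    push_cast at h1' h2'
    refine ⟨by linarith, fun h3 => ?_, 1, by push_cast; linarith, ?_⟩
    · have := huniq v u 0 1 ⟨by push_cast; linarith, by push_cast; linarith⟩ ⟨h1, h2⟩
      omega
    · exact (h.mono v u 1 (by push_cast; linarith)).le

lemma offset_cases_of_window (h : ProperLift L x ℓ) (hwin : ∀ u v, x u < x v + L) {u v : W}
    {k : ℤ} (hk : LiftsMeet L x ℓ v u k) : k = -1 ∨ k = 0 ∨ k = 1 := by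
  obtain ⟨h1, h2⟩ := hk
  have hL := h.L_pos
  have hu := h.len_lt u
  have hv := h.len_lt v
  have huv := hwin u v
  have hvu := hwin v u
  have e1 : k < 2 := int_lt_of_mul_lt hL (by push_cast; linarith)
  have e2 : -2 < k := int_lt_of_mul_lt hL (by push_cast; linarith)
  omega

end Cut

open Classical in
/-- Each edge avoiding `S` corresponds to two ordered pairs of vertices outside `S`. -/
lemma card_pairs_eq_two_mul_ncard {V : Type*} [Fintype V] (G : SimpleGraph V) (S : Set V)
    (E : Set (Sym2 V)) (hE : E ⊆ G.edgeSet) (hES : ∀ e ∈ E, ∀ x ∈ e, x ∉ S) :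
    (Finset.univ.filter fun p : {v | v ∉ S} × {v | v ∉ S} => s((p.1 : V), (p.2 : V)) ∈ E).card =
      2 * E.ncard := by
  rw [Set.ncard_eq_toFinset_card', mul_comm, ← smul_eq_mul, ← Finset.sum_const]
  rw [Finset.card_eq_sum_card_fiberwise (f := fun p => s((p.1 : V), (p.2 : V))) (t := E.toFinset)
    (fun p hp => by simpa using hp)]
  refine Finset.sum_congr rfl fun e he => ?_
  rw [Set.mem_toFinset] at he
  induction e with | _ a b
  have hab : a ≠ b := SimpleGraph.Adj.ne (hE he)
  have ha : a ∉ S := hES _ he a (Sym2.mem_mk_left a b)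
  have hb : b ∉ S := hES _ he b (Sym2.mem_mk_right a b)
  rw [Finset.card_eq_two]
  refine ⟨(⟨a, ha⟩, ⟨b, hb⟩), (⟨b, hb⟩, ⟨a, ha⟩), by simp [hab], ?_⟩
  ext ⟨⟨p, hp⟩, ⟨q, hq⟩⟩
  simp only [Finset.mem_filter, Finset.mem_univ, true_and, Finset.mem_insert,
    Finset.mem_singleton, Prod.mk.injEq, Subtype.mk.injEq, Sym2.eq_iff]
  constructor
  · exact fun h => h.2
  · rintro (⟨rfl, rfl⟩ | ⟨rfl, rfl⟩)
    · exact ⟨he, by simp⟩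
    · exact ⟨by rwa [Sym2.eq_swap], by simp⟩

lemma PreArcModel.hasHoleLift {V : Type*} {G : SimpleGraph V} {A : PreArcModel V}
    (hm : A.IsModelOf G) (hG : G.HasHole) : HasHoleLift A.L A.src A.len := by
  obtain ⟨n, f, hn, hinj, hf⟩ := hG
  refine ⟨n, f, hn, fun i j hij => ?_⟩
  rw [← A.arc_inter_arc_nonempty_iff, ← hm.2 _ _ (hinj.ne hij), hf]

/-- In a non-chordal proper Helly circular-arc graph, any editing set
using no edge additions can be replaced by one whose deleted edges are
`E→_{A - V_-}(α)` for some point `α`, without increasing either budget. -/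
theorem stmt13 {V : Type*} [Fintype V] (G : SimpleGraph V) (A : PreArcModel V)
    (hm : A.IsModelOf G) (hproper : A.Proper) (hhelly : A.Helly) (hnc : ¬ G.Chordal)
    (Vs : Set V) (Es : Set (Sym2 V)) (hes : IsEditingSet G Vs Es ∅) :
    ∃ (α : AddCircle A.L) (Vm : Set V), Vm.ncard ≤ Vs.ncard ∧
      IsEditingSet G Vm (A.EoutAvoid G Vm α) ∅ ∧
      (A.EoutAvoid G Vm α).ncard ≤ Es.ncard := by
  classical
  have hlift := A.properLift hproper hm.1
  have hhole : HasHoleLift A.L A.src A.len := PreArcModel.hasHoleLift hm (not_not.1 hnc)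
  have huniq := @liftsMeet_offset_unique V _ _ _ hlift (A.tripleHelly hhelly) hhole
  have htri := @liftsMeet_triangle V _ _ _ hlift (A.tripleHelly hhelly) hhole
  have hadj : ∀ u v : V, u ≠ v → (G.Adj u v ↔ ∃ k, LiftsMeet A.L A.src A.len u v k) :=
    fun u v huv => by rw [hm.2 u v huv, A.arc_inter_arc_nonempty_iff]
  obtain ⟨hEs, hEsV, -, f, hf⟩ := hes
  set W := {v | v ∉ Vs}
  set x : W → ℝ := fun w => A.src w
  set ℓ : W → ℝ := fun w => A.len w
  have hx : ProperLift A.L x ℓ := hlift.comp Subtype.val_injective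
  obtain ⟨φ, hφ⟩ := exists_shift_realizing (L := A.L) (x := x) (ℓ := ℓ) _ hf
    (fun u v huv => (hadj u v (by rintro e; exact huv.ne (Subtype.ext e))).1 (by
      simp only [SimpleGraph.comap_adj, SimpleGraph.fromEdgeSet_adj] at huv
      exact (huv.1.resolve_right (Set.notMem_empty _)).1))
    (fun u v w a b c => htri)
  obtain ⟨ψ, hwin, hcard⟩ := exists_shift_window (hx.shift φ)
  set y : W → ℝ := fun w => x w + φ w * A.L + ψ w * A.L with hy
  have hly : ProperLift A.L y ℓ := (hx.shift φ).shift ψ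
  have hmeety : ∀ u v k, LiftsMeet A.L y ℓ u v k ↔
      LiftsMeet A.L A.src A.len u v (k + ψ v - ψ u + φ v - φ u) := fun u v k => by
    rw [hy, liftsMeet_shift, liftsMeet_shift]
    rfl
  have hadjy : ∀ u v : W, u ≠ v → (G.Adj u v ↔ ∃ k, LiftsMeet A.L y ℓ u v k) := by
    intro u v huv
    rw [hadj u v (fun e => huv (Subtype.ext e))]
    simp only [hmeety]
    constructor
    · rintro ⟨k, hk⟩
      exact ⟨k - (ψ v - ψ u + φ v - φ u), by convert hk using 1; ring⟩
    · rintro ⟨k, hk⟩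
      exact ⟨_, hk⟩
  have huniqy : ∀ (u v : W) (k k' : ℤ), LiftsMeet A.L y ℓ u v k → LiftsMeet A.L y ℓ u v k' →
      k = k' := by
    intro u v k k' h1 h2
    rw [hmeety] at h1 h2
    have := huniq h1 h2
    omega
  have hmem : ∀ (v : W) (z : ℝ), (z : AddCircle A.L) ∈ A.arc v ↔ LiftMem A.L y ℓ v z := by
    intro v z
    rw [A.mem_arc_iff, hy, liftMem_shift, liftMem_shift]
    rfl
  have hcp : ∀ v : W, A.cp v = ((y v + ℓ v : ℝ) : AddCircle A.L) := fun v =>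
    PreArcModel.coe_eq_coe_iff.2 ⟨φ v + ψ v, by simp only [hy, x, ℓ]; push_cast; ring⟩
  obtain ⟨α, hα⟩ : ∃ α : AddCircle A.L, ∀ u v : W, u ≠ v → G.Adj u v →
      (s((u : V), (v : V)) ∈ A.EoutAvoid G Vs α ↔ ¬ LiftsMeet A.L y ℓ u v 0) := by
    rcases isEmpty_or_nonempty W with hW | ⟨⟨w⟩⟩
    · exact ⟨0, fun u => (hW.false u).elim⟩
    obtain ⟨m, -, hmax⟩ := Finset.exists_max_image Finset.univ y ⟨w, Finset.mem_univ _⟩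
    replace hmax : ∀ w, y w ≤ y m := fun w => hmax w (Finset.mem_univ _)
    refine ⟨(y m : ℝ), fun u v huv huv' => ?_⟩
    obtain ⟨k, hk⟩ := (hadjy u v huv).1 huv'
    have h1 := crosses_top_iff hly hwin hmax huniqy hk
    have h2 := crosses_top_iff hly hwin hmax huniqy ((liftsMeet_comm _ _ _).1 hk)
    have h0 : LiftsMeet A.L y ℓ u v 0 ↔ k = 0 :=
      ⟨fun h => huniqy _ _ _ _ hk h, fun h => h ▸ hk⟩
    have hcases := offset_cases_of_window hly hwin hk
    rw [← hmem, ← hmem, ← hmem, ← hcp] at h1 h2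
    rw [h0]
    constructor
    · rintro ⟨a, b, hab, -, -, -, hr⟩
      rcases Sym2.eq_iff.1 hab with ⟨e1, e2⟩ | ⟨e1, e2⟩
      · rw [← e1, ← e2, h1] at hr
        omega
      · rw [← e1, ← e2, h2] at hr
        omega
    · intro hk0
      rcases hcases with e | e | e
      · exact ⟨v, u, Sym2.eq_swap, huv'.symm, v.2, u.2, h2.2 (by omega)⟩
      · exact absurd e hk0
      · exact ⟨u, v, rfl, huv', u.2, v.2, h1.2 e⟩
  have hsub : A.EoutAvoid G Vs α ⊆ G.edgeSet := by
    rintro _ ⟨a, b, rfl, hab, -⟩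
    exact hab
  have havoid : ∀ e ∈ A.EoutAvoid G Vs α, ∀ a ∈ e, a ∉ Vs := by
    rintro _ ⟨a, b, rfl, -, ha, hb, -⟩ c hc
    rcases Sym2.mem_iff.1 hc with rfl | rfl
    · exact ha
    · exact hb
  refine ⟨α, Vs, le_rfl, ⟨hsub, havoid, by simp, ?_⟩, ?_⟩
  · obtain ⟨g, hg⟩ := exists_unit_map hly
    refine ⟨g, fun u v huv => ?_⟩
    rw [← hg u v huv]
    simp only [SimpleGraph.comap_adj, SimpleGraph.fromEdgeSet_adj, Set.union_empty, Set.mem_sdiff,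
      SimpleGraph.mem_edgeSet, Function.Embedding.subtype_apply]
    constructor
    · rintro ⟨⟨h1, h2⟩, -⟩
      exact not_not.1 fun h => h2 ((hα u v huv h1).2 h)
    · intro h
      have h1 := (hadjy u v huv).2 ⟨0, h⟩
      exact ⟨⟨h1, fun h2 => (hα u v huv h1).1 h2 h⟩, h1.ne⟩
  · have e1 : (Finset.univ.filter fun p : W × W =>
        s((p.1 : V), (p.2 : V)) ∈ A.EoutAvoid G Vs α).card = 2 * (A.EoutAvoid G Vs α).ncard := by
      convert card_pairs_eq_two_mul_ncard G Vs _ hsub havoid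
    have e2 : (Finset.univ.filter fun p : W × W =>
        s((p.1 : V), (p.2 : V)) ∈ Es).card = 2 * (Es).ncard := by
      convert card_pairs_eq_two_mul_ncard G Vs _ hEs hEsV
    have e3 : (Finset.univ.filter fun p : W × W =>
        s((p.1 : V), (p.2 : V)) ∈ A.EoutAvoid G Vs α).card + (meetPairs A.L y ℓ).card ≤
        (Finset.univ.filter fun p : W × W => G.Adj p.1 p.2).card := by
      rw [card_meetPairs]
      refine add_le_card_filter (fun p hp => hsub hp) ?_ ?_
      · rintro p ⟨h1, h2⟩
        exact (hadjy _ _ h1).2 ⟨0, h2⟩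
      · rintro p h1 ⟨h2, h3⟩
        exact (hα _ _ h2 (hsub h1)).1 h1 h3
    have e4 : (Finset.univ.filter fun p : W × W => G.Adj p.1 p.2).card ≤
        (Finset.univ.filter fun p : W × W => s((p.1 : V), (p.2 : V)) ∈ Es).card +
        (meetPairs A.L (fun w => x w + φ w * A.L) ℓ).card := by
      rw [card_meetPairs]
      refine card_filter_le_add fun p hp => or_iff_not_imp_left.2 fun hpE => ?_
      refine ⟨fun e => hp.ne (congrArg _ e), hφ _ _ ?_⟩
      simp only [SimpleGraph.comap_adj, SimpleGraph.fromEdgeSet_adj, Set.union_empty, Set.mem_sdiff,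
        SimpleGraph.mem_edgeSet, Function.Embedding.subtype_apply]
      exact ⟨⟨hp, hpE⟩, hp.ne⟩
    omega
end

section
/- Every fat W_5 G has a maximum spanning unit interval subgraph Ḡ such that N_Ḡ[u] = N_Ḡ[v] for every pair of vertices u, v of G with N_G[u] = N_G[v], where N_H[x] denotes the closed neighborhood of x in the graph H. -/
/-- The unit interval graph with model `f`. -/
def unitIntervalGraph {V : Type*} (f : V → ℝ) : SimpleGraph V where
  Adj u v := u ≠ v ∧ |f u - f v| ≤ 1
  symm := ⟨fun u v h => ⟨h.1.symm, by rw [abs_sub_comm]; exact h.2⟩⟩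
  loopless := ⟨fun _ h => h.1 rfl⟩

lemma isUnitIntervalGraph_unitIntervalGraph {V : Type*} (f : V → ℝ) :
    (unitIntervalGraph f).IsUnitIntervalGraph :=
  ⟨f, fun _ _ h => ⟨fun h' => h'.2, fun h' => ⟨h, h'⟩⟩⟩

lemma SimpleGraph.IsUnitIntervalGraph.exists_eq {V : Type*} {H : SimpleGraph V}
    (h : H.IsUnitIntervalGraph) : ∃ f : V → ℝ, H = unitIntervalGraph f := by
  obtain ⟨f, hf⟩ := h
  refine ⟨f, ?_⟩
  ext u v
  exact ⟨fun h => ⟨h.ne, (hf u v h.ne).1 h⟩, fun h => (hf u v h.1).2 h.2⟩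

lemma SimpleGraph.isUnitIntervalGraph_bot {V : Type*} [Fintype V] :
    (⊥ : SimpleGraph V).IsUnitIntervalGraph := by
  refine ⟨fun v => 2 * ((Fintype.equivFin V v : ℕ) : ℝ), fun u v huv => ?_⟩
  simp only [SimpleGraph.bot_adj, false_iff, not_le]
  have hne : ((Fintype.equivFin V u : ℕ) : ℤ) - (Fintype.equivFin V v : ℕ) ≠ 0 := by
    intro h
    exact huv ((Fintype.equivFin V).injective (Fin.ext (by omega)))
  have h1 : (1 : ℝ) ≤ |((Fintype.equivFin V u : ℕ) : ℝ) - (Fintype.equivFin V v : ℕ)| := by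
    exact_mod_cast Int.one_le_abs hne
  rw [← mul_sub, abs_mul, abs_two]
  linarith

/-- The indicator of the reals `a` and `b` being at distance at most one. -/
noncomputable def unitIndicator (a b : ℝ) : ℤ := if |a - b| ≤ 1 then 1 else 0

lemma unitIndicator_comm (a b : ℝ) : unitIndicator a b = unitIndicator b a := by
  simp [unitIndicator, abs_sub_comm]

lemma unitIndicator_self (a : ℝ) : unitIndicator a a = 1 := by
  simp [unitIndicator]

lemma unitIndicator_le_one (a b : ℝ) : unitIndicator a b ≤ 1 := by
  unfold unitIndicator; split_ifs <;> simp

lemma two_mul_ncard_edgeSet_unitIntervalGraph {V : Type*} [Fintype V] (f : V → ℝ) :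
    2 * ((unitIntervalGraph f).edgeSet.ncard : ℤ) + Fintype.card V =
      ∑ x, ∑ y, unitIndicator (f x) (f y) := by
  classical
  have hdeg (x : V) : ∑ y, unitIndicator (f x) (f y) = (unitIntervalGraph f).degree x + 1 := by
    rw [← Finset.add_sum_erase _ _ (Finset.mem_univ x), unitIndicator_self, add_comm,
      ← SimpleGraph.card_neighborFinset_eq_degree]
    simp only [unitIndicator, Finset.sum_boole]
    congr 3
    ext y
    rw [SimpleGraph.mem_neighborFinset]
    simp [unitIntervalGraph, eq_comm]
  have hsum := (unitIntervalGraph f).sum_degrees_eq_twice_card_edges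
  rw [← Set.ncard_coe_finset, SimpleGraph.coe_edgeFinset] at hsum
  simp_rw [hdeg]
  rw [Finset.sum_add_distrib]
  simp only [Finset.sum_const, Finset.card_univ, nsmul_eq_mul, mul_one]
  exact_mod_cast congrArg (· + Fintype.card V) hsum.symm

lemma sum_sum_eq_erase_of_symm {V : Type*} [Fintype V] [DecidableEq V] (p : V → V → ℤ)
    (hp : ∀ x y, p x y = p y x) (u : V) :
    ∑ x, ∑ y, p x y = ∑ x ∈ Finset.univ.erase u, ∑ y ∈ Finset.univ.erase u, p x y +
      2 * ∑ y ∈ Finset.univ.erase u, p u y + p u u := by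
  have hsplit (g : V → ℤ) : ∑ y, g y = g u + ∑ y ∈ Finset.univ.erase u, g y :=
    (Finset.add_sum_erase _ _ (Finset.mem_univ u)).symm
  rw [hsplit]
  simp_rw [hsplit (p _), Finset.sum_add_distrib, hp _ u]
  ring

/-- The change in the (doubled) number of edges when `u` is moved onto `v`. -/
lemma sum_unitIndicator_update {V : Type*} [Fintype V] [DecidableEq V] (f : V → ℝ) (u v : V) :
    ∑ x, ∑ y, unitIndicator (Function.update f u (f v) x) (Function.update f u (f v) y) =
      ∑ x, ∑ y, unitIndicator (f x) (f y) +
        2 * ((∑ y, unitIndicator (f v) (f y) - unitIndicator (f u) (f v)) -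
          (∑ y, unitIndicator (f u) (f y) - 1)) := by
  rw [sum_sum_eq_erase_of_symm _ (fun _ _ => unitIndicator_comm _ _) u,
    sum_sum_eq_erase_of_symm (fun x y => unitIndicator (f x) (f y))
      (fun _ _ => unitIndicator_comm _ _) u]
  have hv := Finset.add_sum_erase _ (fun y => unitIndicator (f v) (f y)) (Finset.mem_univ u)
  have hu := Finset.add_sum_erase _ (fun y => unitIndicator (f u) (f y)) (Finset.mem_univ u)
  have hf {y : V} (hy : y ∈ Finset.univ.erase u) : Function.update f u (f v) y = f y :=
    Function.update_of_ne (Finset.ne_of_mem_erase hy) _ _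
  have h1 : ∑ x ∈ Finset.univ.erase u, ∑ y ∈ Finset.univ.erase u,
      unitIndicator (Function.update f u (f v) x) (Function.update f u (f v) y) =
      ∑ x ∈ Finset.univ.erase u, ∑ y ∈ Finset.univ.erase u, unitIndicator (f x) (f y) :=
    Finset.sum_congr rfl fun x hx => Finset.sum_congr rfl fun y hy => by rw [hf hx, hf hy]
  have h2 : ∑ y ∈ Finset.univ.erase u,
      unitIndicator (Function.update f u (f v) u) (Function.update f u (f v) y) =
      ∑ y ∈ Finset.univ.erase u, unitIndicator (f v) (f y) :=
    Finset.sum_congr rfl fun y hy => by rw [hf hy, Function.update_self]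
  rw [h1, h2]
  simp only [unitIndicator_self] at hu ⊢
  rw [unitIndicator_comm (f u) (f v)]
  linarith

lemma unitIntervalGraph_update_le {V : Type*} [DecidableEq V] {G : SimpleGraph V} {f : V → ℝ}
    (hf : unitIntervalGraph f ≤ G) {u v : V}
    (huv : G.neighborSet u ∪ {u} = G.neighborSet v ∪ {v}) :
    unitIntervalGraph (Function.update f u (f v)) ≤ G := by
  have hu {y : V} (hy : y ≠ u) (h : |f v - f y| ≤ 1) : G.Adj u y := by
    have hmem : y ∈ G.neighborSet v ∪ {v} := by
      by_cases hyv : y = v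
      · exact Or.inr hyv
      · exact Or.inl (hf ⟨Ne.symm hyv, h⟩)
    rw [← huv] at hmem
    exact hmem.resolve_right hy
  rintro x y ⟨hxy, h⟩
  by_cases hx : x = u
  · subst hx
    rw [Function.update_self, Function.update_of_ne hxy.symm] at h
    exact hu hxy.symm h
  · by_cases hy : y = u
    · subst hy
      rw [Function.update_self, Function.update_of_ne hx, abs_sub_comm] at h
      exact (hu hx h).symm
    · rw [Function.update_of_ne hx, Function.update_of_ne hy] at h
      exact hf ⟨hxy, h⟩

/-- Moving a vertex onto a true twin preserves maximality. -/
lemma IsMaxSpanningUIG.update {V : Type*} [Fintype V] [DecidableEq V] {G : SimpleGraph V}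
    {f : V → ℝ} (hf : IsMaxSpanningUIG G (unitIntervalGraph f)) {u v : V}
    (huv : G.neighborSet u ∪ {u} = G.neighborSet v ∪ {v}) :
    IsMaxSpanningUIG G (unitIntervalGraph (Function.update f u (f v))) := by
  obtain ⟨hle, -, hmax⟩ := hf
  refine ⟨unitIntervalGraph_update_le hle huv, isUnitIntervalGraph_unitIntervalGraph _,
    fun H hH hH' => (hmax H hH hH').trans ?_⟩
  have hswap := hmax _ (unitIntervalGraph_update_le hle huv.symm)
    (isUnitIntervalGraph_unitIntervalGraph _)
  have e0 := two_mul_ncard_edgeSet_unitIntervalGraph f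
  have e1 := two_mul_ncard_edgeSet_unitIntervalGraph (Function.update f u (f v))
  have e2 := two_mul_ncard_edgeSet_unitIntervalGraph (Function.update f v (f u))
  rw [sum_unitIndicator_update] at e1 e2
  rw [unitIndicator_comm (f v) (f u)] at e2
  have := unitIndicator_le_one (f u) (f v)
  omega

lemma SimpleGraph.exists_isMaxSpanningUIG {V : Type*} [Fintype V] (G : SimpleGraph V) :
    ∃ Gb, IsMaxSpanningUIG G Gb := by
  obtain ⟨Gb, hGb, hmax⟩ := Set.exists_max_image {H : SimpleGraph V | H ≤ G ∧ H.IsUnitIntervalGraph}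
    (fun H => H.edgeSet.ncard) (Set.toFinite _) ⟨⊥, bot_le, isUnitIntervalGraph_bot⟩
  exact ⟨Gb, hGb.1, hGb.2, fun H h1 h2 => hmax H ⟨h1, h2⟩⟩

/-- Any finite set of vertices can be moved onto chosen representatives of their classes of true
twins, without losing maximality. -/
lemma IsMaxSpanningUIG.exists_eq_rep {V : Type*} [Fintype V] {G : SimpleGraph V}
    (rep : V → V) (hrep : ∀ v, G.neighborSet v ∪ {v} = G.neighborSet (rep v) ∪ {rep v})
    (hidem : ∀ v, rep (rep v) = rep v) (S : Finset V) :
    ∃ f : V → ℝ, IsMaxSpanningUIG G (unitIntervalGraph f) ∧ ∀ v ∈ S, f v = f (rep v) := by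
  classical
  induction S using Finset.induction_on with
  | empty =>
    obtain ⟨Gb, hGb⟩ := G.exists_isMaxSpanningUIG
    obtain ⟨f, rfl⟩ := hGb.2.1.exists_eq
    exact ⟨f, hGb, by simp⟩
  | insert u S hu ih =>
    obtain ⟨f, hf, hS⟩ := ih
    refine ⟨_, hf.update (hrep u), fun v hv => ?_⟩
    by_cases hfix : rep u = u
    · rw [hfix, Function.update_eq_self]
      rcases Finset.mem_insert.1 hv with rfl | hv
      · rw [hfix]
      · exact hS v hv
    · have hne (w : V) : rep w ≠ u := fun h => hfix (by rw [← h, hidem])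
      rw [Function.update_of_ne (hne v)]
      rcases Finset.mem_insert.1 hv with rfl | hvS
      · rw [Function.update_self]
      · rw [Function.update_of_ne (ne_of_mem_of_not_mem hvS hu), hS v hvS]

/-- Every fat `W_5` has a maximum spanning unit interval subgraph that
preserves true twins (equal closed neighborhoods). -/
theorem stmt14 {V : Type*} [Fintype V] (G : SimpleGraph V) (hfat : G.IsFatW5) :
    ∃ Gb : SimpleGraph V, IsMaxSpanningUIG G Gb ∧
      ∀ u v : V, G.neighborSet u ∪ {u} = G.neighborSet v ∪ {v} →
        Gb.neighborSet u ∪ {u} = Gb.neighborSet v ∪ {v} := by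
  classical
  let s : Setoid V := Setoid.ker fun v => G.neighborSet v ∪ {v}
  let rep : V → V := fun v => (Quotient.mk s v).out
  have hrep (v : V) : G.neighborSet v ∪ {v} = G.neighborSet (rep v) ∪ {rep v} :=
    (Quotient.mk_out (s := s) v).symm
  have hrep_eq {u v : V} (h : G.neighborSet u ∪ {u} = G.neighborSet v ∪ {v}) : rep u = rep v :=
    congrArg Quotient.out (Quotient.sound (s := s) h)
  obtain ⟨f, hf, hfrep⟩ := IsMaxSpanningUIG.exists_eq_rep rep hrep
    (fun v => hrep_eq (hrep v).symm) Finset.univ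
  refine ⟨_, hf, fun u v huv => ?_⟩
  have hfuv : f u = f v := by
    rw [hfrep u (Finset.mem_univ u), hfrep v (Finset.mem_univ v), hrep_eq huv]
  have hN (x : V) : (unitIntervalGraph f).neighborSet x ∪ {x} = {y | |f x - f y| ≤ 1} := by
    ext y
    by_cases hy : y = x
    · simp [hy]
    · simp [unitIntervalGraph, hy, Ne.symm hy]
  rw [hN, hN, hfuv]
end

section
/- Let G be a fat W_5 with fat-hole cliques K_0, ..., K_4 and hub K_5. Then for each i ∈ {0, ..., 4}, the graph G − K_i obtained by deleting all vertices of K_i is a unit interval graph. -/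
/-- Positions, in multiples of one fifth, of a unit interval model of a fat `W_5` without its
hole clique `i`: the remaining hole cliques sit at `0, 4, 6, 10` and the hub at `5`. -/
def fatW5Position (i p : Fin 6) : ℤ :=
  if p = 5 then 5
  else match (p.val + 5 - i.val) % 5 with
    | 1 => 0
    | 2 => 4
    | 3 => 6
    | _ => 10

theorem fatW5Rel_iff_abs_position_sub_le (i p q : Fin 6) (hi : i.val < 5) (hp : p ≠ i)
    (hq : q ≠ i) : fatW5Rel p q ↔ |fatW5Position i p - fatW5Position i q| ≤ 5 := by
  unfold fatW5Rel
  revert i p q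
  decide

/-- Deleting any one of the five fat-hole cliques of a fat `W_5`
leaves a unit interval graph. -/
theorem stmt15 {V : Type*} [Fintype V] (G : SimpleGraph V) (part : V → Fin 6)
    (hsurj : Function.Surjective part)
    (hadj : ∀ u v : V, u ≠ v → (G.Adj u v ↔ fatW5Rel (part u) (part v)))
    (i : Fin 6) (hi : i.val < 5) :
    (G.induce {v | part v ≠ i}).IsUnitIntervalGraph := by
  refine ⟨fun v => (fatW5Position i (part v) : ℝ) / 5, fun u v huv => ?_⟩
  rw [SimpleGraph.induce_adj, hadj _ _ (Subtype.coe_injective.ne huv),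
    fatW5Rel_iff_abs_position_sub_le i _ _ hi u.2 v.2, ← sub_div, abs_div,
    abs_of_pos (by norm_num : (0 : ℝ) < 5), div_le_one (by norm_num)]
  exact_mod_cast Iff.rfl
end
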